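/- arXiv:2303.08382 — 2 statements merged into one kernel-verified Lean document; each statement's English description precedes it below -/
import Mathlib

section
/- Let v ∈ C_b(Ω,ℝ^d), let ω ∈ Ω* ∩ Ω_{p,q} for some p,q > 1, and let μ be a subsequential weak limit of the measures {μ_r^{ω,v} : r ≥ 1} on Ω × V. Then the second marginal of μ is supported on curl-free fields: μ( Ω × ⋂_{1≤i<j≤d} {u ∈ V : u_i(0) + u_j(e_i) = u_j(0) + u_i(e_j)} ) = 1. -/
open MeasureTheory Filter Topology Matrix
open scoped ENNReal NNReal

noncomputable section

namespace DetCond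

/-- Vertices of `ℤ^d`. -/
abbrev Vert (d : ℕ) := Fin d → ℤ

/-- Index of the (unordered) nearest-neighbour edge `(x, x + e i)` of `ℤ^d`;
the set of these indices is in natural bijection with `E(ℤ^d)` modulo orientation. -/
abbrev EdgeIx (d : ℕ) := Vert d × Fin d

/-- The space `Ω = (0,∞)^{E(ℤ^d)}` of (symmetric) conductance configurations, with
its product topology and product σ-algebra. -/
abbrev EnvSp (d : ℕ) := {ω : EdgeIx d → ℝ // ∀ e, 0 < ω e}

/-- The `i`-th coordinate unit vector of `ℤ^d`. -/
def unitv (d : ℕ) (i : Fin d) : Vert d := fun j => if j = i then 1 else 0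

/-- The translation `τ_x` acting on environments: `c_{τ_x ω}(y,z) = c_ω(y+x,z+x)`. -/
def shift (d : ℕ) (x : Vert d) (ω : EnvSp d) : EnvSp d :=
  ⟨fun e => ω.1 (e.1 + x, e.2), fun e => ω.2 (e.1 + x, e.2)⟩

/-- The conductance `c_ω(x,y)`; it vanishes when `x,y` are not nearest neighbours
and is symmetric in `x,y` by construction. -/
def cnd (d : ℕ) (ω : EnvSp d) (x y : Vert d) : ℝ :=
  ∑ i, ((if y = x + unitv d i then ω.1 (x, i) else 0) +
        (if x = y + unitv d i then ω.1 (y, i) else 0))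

/-- `π_ω(x) = Σ_{z : (x,z) ∈ E(ℤ^d)} c_ω(x,z)`. -/
def piOf (d : ℕ) (ω : EnvSp d) (x : Vert d) : ℝ :=
  ∑ i, (ω.1 (x, i) + ω.1 (x - unitv d i, i))

/-- The box `Λ_r = [-r,r]^d ∩ ℤ^d`. -/
def box (d : ℕ) (r : ℝ) : Finset (Vert d) :=
  Fintype.piFinset fun _ : Fin d => Finset.Icc ⌈-r⌉ ⌊r⌋

/-- The nearest neighbours of `x` in `ℤ^d`. -/
def nbrs (d : ℕ) (x : Vert d) : Finset (Vert d) :=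
  (Finset.univ.image fun i => x + unitv d i) ∪ (Finset.univ.image fun i => x - unitv d i)

/-- The set `E(Λ)` of edges incident with at least one vertex of `Λ`
(one index per unordered edge). -/
def edgesIn (d : ℕ) (Λ : Finset (Vert d)) : Finset (EdgeIx d) :=
  Λ.biUnion fun x =>
    (Finset.univ.image fun i => (x, i)) ∪ (Finset.univ.image fun i => (x - unitv d i, i))

/-- Bounded functions on `Ω`. -/
def IsBdd (d : ℕ) (f : EnvSp d → ℝ) : Prop := ∃ M, ∀ ω, |f ω| ≤ M

/-- Local functions: `f` depends only on the coordinates in some finite set `B` of edges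
and, viewed as a function of those coordinates, has compact support in `(0,∞)^B`. -/
def IsLocalFn (d : ℕ) (f : EnvSp d → ℝ) : Prop :=
  ∃ B : Finset (EdgeIx d),
    (∀ ω₁ ω₂ : EnvSp d, (∀ e ∈ B, ω₁.1 e = ω₂.1 e) → f ω₁ = f ω₂) ∧
    ∃ a b : ℝ, 0 < a ∧ ∀ ω : EnvSp d, (∃ e ∈ B, ω.1 e < a ∨ b < ω.1 e) → f ω = 0

/-- `ℓ_ω(f) = L`, i.e. the block averages of the translates of `f` converge to `L`. -/
def avgTo (d : ℕ) (ω : EnvSp d) (f : EnvSp d → ℝ) (L : ℝ) : Prop :=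
  Tendsto (fun n : ℕ => (∑ x ∈ box d (n : ℝ), f (shift d x ω)) / ((box d (n : ℝ)).card : ℝ))
    atTop (𝓝 L)

/-- `ω` is averaging: `ℓ_ω(f)` exists for every continuous local `f`. -/
def Averaging (d : ℕ) (ω : EnvSp d) : Prop :=
  ∀ f : EnvSp d → ℝ, Continuous f → IsLocalFn d f → ∃ L, avgTo d ω f L

/-- `ω` is tempered, i.e. `ω ∈ Ω'`. -/
def Tempered (d : ℕ) (ω : EnvSp d) : Prop :=
  Tendsto (fun ε : ℝ =>
      limsup (fun n : ℕ =>
        (∑ e ∈ edgesIn d (box d (n : ℝ)),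
            (if ε ≤ ω.1 e ∧ ω.1 e ≤ ε⁻¹ then (0:ℝ) else 1)) / (n : ℝ) ^ d) atTop)
    (𝓝[>] 0) (𝓝 0)

/-- `P` is the measure `ℙ_ω` associated with an averaging tempered `ω`:
the unique probability measure whose expectation of every bounded continuous function
is the corresponding block-average limit `ℓ_ω(f)`. -/
def IsEnvLaw (d : ℕ) (ω : EnvSp d) (P : Measure (EnvSp d)) : Prop :=
  IsProbabilityMeasure P ∧
    ∀ f : EnvSp d → ℝ, Continuous f → IsBdd d f → avgTo d ω f (∫ ω', f ω' ∂P)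

/-- Ergodicity of a measure on `Ω` with respect to the translations of `ℤ^d`. -/
def ErgodicEnv (d : ℕ) (P : Measure (EnvSp d)) : Prop :=
  ∀ A : Set (EnvSp d), MeasurableSet A → (∀ x : Vert d, shift d x ⁻¹' A = A) →
    P A = 0 ∨ P A = 1

/-- `ω ∈ Ω⋆`: tempered, averaging, and the associated measure `ℙ_ω` is ergodic. -/
def InOmegaStar (d : ℕ) (ω : EnvSp d) : Prop :=
  Tempered d ω ∧ Averaging d ω ∧
    ∀ P : Measure (EnvSp d), IsEnvLaw d ω P → ErgodicEnv d P

/-- `ω ∈ Ω_{p,q}`. -/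
def InOmegaPQ (d : ℕ) (p q : ℝ) (ω : EnvSp d) : Prop :=
  (∃ C : ℝ, ∀ n : ℕ, 1 ≤ n →
      (∑ e ∈ edgesIn d (box d (n : ℝ)), ω.1 e ^ p) / (n : ℝ) ^ d ≤ C) ∧
  (∃ C : ℝ, ∀ n : ℕ, 1 ≤ n →
      (∑ e ∈ edgesIn d (box d (n : ℝ)), ω.1 e ^ (-q)) / (n : ℝ) ^ d ≤ C)

/-- The path space of the discrete-time walk. -/
abbrev Path (d : ℕ) := ℕ → Vert d

/-- One-step transition probabilities `𝖯_ω(x,y) = c_ω(x,y)/π_ω(x)`. -/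
def transP (d : ℕ) (ω : EnvSp d) (x y : Vert d) : ℝ := cnd d ω x y / piOf d ω x

/-- `μ` is the law `P_ω^{x₀}` of the random walk among the conductances `ω`
started at `x₀`: a probability measure on the path space with the prescribed
finite-dimensional (cylinder) probabilities. -/
def IsWalkLaw (d : ℕ) (ω : EnvSp d) (x₀ : Vert d) (μ : Measure (Path d)) : Prop :=
  IsProbabilityMeasure μ ∧
    ∀ (n : ℕ) (γ : ℕ → Vert d),
      μ {w | ∀ k ≤ n, w k = γ k} =
        (if γ 0 = x₀ then 1 else 0) *
          ∏ k ∈ Finset.range n, ENNReal.ofReal (transP d ω (γ k) (γ (k+1)))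

/-- `n`-step transition probabilities of the discrete-time walk. -/
def stepP (d : ℕ) (ω : EnvSp d) : ℕ → Vert d → Vert d → ℝ
  | 0, x, y => if x = y then 1 else 0
  | n+1, x, y => ∑ z ∈ nbrs d x, transP d ω x z * stepP d ω n z y

/-- `P_ω^x(Y_t = y)` for the constant-speed continuous-time walk `Y_t = X_{N(t)}`,
where `N` is an independent rate-1 Poisson process. -/
def ctP (d : ℕ) (ω : EnvSp d) (t : ℝ) (x y : Vert d) : ℝ :=
  ∑' k : ℕ, Real.exp (-t) * t ^ k / (Nat.factorial k : ℝ) * stepP d ω k x y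

/-- The `ℓ¹`-norm of a vertex of `ℤ^d`. -/
def l1 (d : ℕ) (x : Vert d) : ℝ := ∑ i, |(x i : ℝ)|

/-- A vertex of `ℤ^d` regarded as a point of `ℝ^d`. -/
def ivert (d : ℕ) (x : Vert d) : Fin d → ℝ := fun i => (x i : ℝ)

/-- The linearly interpolated diffusively rescaled walk `B^{(n)}`. -/
def BnProc (d : ℕ) (n : ℕ) (w : Path d) (t : ℝ) : Fin d → ℝ :=
  (Real.sqrt n)⁻¹ •
    (ivert d (w ⌊t * n⌋₊) +
      (t * n - (⌊t * n⌋₊ : ℝ)) • (ivert d (w (⌊t * n⌋₊ + 1)) - ivert d (w ⌊t * n⌋₊)))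


/-- The measure `ℚ_ω` obtained from `ℙ_ω` by tilting with `π(0)`. -/
def Qmeas (d : ℕ) (P : Measure (EnvSp d)) : Measure (EnvSp d) :=
  P.withDensity fun ω' => ENNReal.ofReal (piOf d ω' 0 / ∫ ω'', piOf d ω'' 0 ∂P)

/-- The inner product `⟨f,g⟩_{L²(πμ)}`. -/
def innerP (d : ℕ) (P : Measure (EnvSp d)) (f g : EnvSp d → ℝ) : ℝ :=
  ∫ ω', f ω' * g ω' * piOf d ω' 0 ∂P

/-- The Dirichlet pairing `⟨h, (−L)h⟩_{L²(πμ)}`. -/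
def quadL (d : ℕ) (P : Measure (EnvSp d)) (h : EnvSp d → ℝ) : ℝ :=
  ∫ ω', (∑ z ∈ nbrs d 0, cnd d ω' 0 z * (h ω' - h (shift d z ω'))) * h ω' ∂P

/-- The inner product of `L²(ν)`. -/
def innerQ (d : ℕ) (ν : Measure (EnvSp d)) (f g : EnvSp d → ℝ) : ℝ :=
  ∫ ω', f ω' * g ω' ∂ν

/-- The Dirichlet pairing `⟨h, (−L)h⟩_{L²(ν)}`. -/
def quadQ (d : ℕ) (ν : Measure (EnvSp d)) (h : EnvSp d → ℝ) : ℝ :=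
  ∫ ω', ((piOf d ω' 0)⁻¹ *
      ∑ z ∈ nbrs d 0, cnd d ω' 0 z * (h ω' - h (shift d z ω'))) * h ω' ∂ν

/-- The set whose supremum is the variational characterization
`⟨f,(−L)⁻¹f⟩_{L²(ν)} = sup_h [2⟨h,f⟩ − ⟨h,(−L)h⟩]` (over bounded continuous `h`);
`⟨f,(−L)⁻¹f⟩_{L²(ν)} < ∞` means this set is bounded above. -/
def invPairSet (d : ℕ) (ν : Measure (EnvSp d)) (f : EnvSp d → ℝ) : Set ℝ :=
  {r | ∃ h : EnvSp d → ℝ, Continuous h ∧ IsBdd d h ∧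
        r = 2 * innerQ d ν h f - quadQ d ν h}

/-- The function `f(ω) = π_ω(0)⁻¹ ∇⋆(c v)(ω)` built from a vector field `v`. -/
def fDiv (d : ℕ) (v : EnvSp d → Fin d → ℝ) (ω : EnvSp d) : ℝ :=
  (piOf d ω 0)⁻¹ *
    ∑ i, (cnd d ω 0 (unitv d i) * v ω i -
          cnd d ω (-(unitv d i)) 0 * v (shift d (-(unitv d i)) ω) i)

/-- The inner product of `ℓ²(Λ,π_ω)`. -/
def innerF (d : ℕ) (ω : EnvSp d) (Λ : Finset (Vert d)) (f g : Vert d → ℝ) : ℝ :=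
  ∑ x ∈ Λ, f x * g x * piOf d ω x

/-- The pairing `⟨h, (−𝖫_ω)h⟩_{ℓ²(Λ,π_ω)}` for `h` vanishing outside `Λ`. -/
def quadF (d : ℕ) (ω : EnvSp d) (Λ : Finset (Vert d)) (h : Vert d → ℝ) : ℝ :=
  ∑ x ∈ Λ, (∑ z ∈ nbrs d x, cnd d ω x z * (h x - h z)) * h x

/-- `⟨f, (−𝖫_ω)⁻¹_Λ f⟩_{ℓ²(Λ,π_ω)}` via its variational characterization
`sup_h [2⟨h,f⟩ − ⟨h,(−𝖫_ω)h⟩]` over `h ∈ ℓ²(Λ,π_ω)`. -/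
def invPairF (d : ℕ) (ω : EnvSp d) (Λ : Finset (Vert d)) (f : Vert d → ℝ) : ℝ :=
  sSup {r | ∃ h : Vert d → ℝ, (∀ x ∉ Λ, h x = 0) ∧
      r = 2 * innerF d ω Λ h f - quadF d ω Λ h}

/-- The antisymmetric edge function `v∘τ(ω)`: the value assigned to the
edge `(x, x+e_i)` is `v_i(τ_x(ω))`. -/
def efield (d : ℕ) (v : EnvSp d → Fin d → ℝ) (ω : EnvSp d) : Vert d → Fin d → ℝ :=
  fun x i => v (shift d x ω) i

/-- The discrete gradient `∇h` of `h : ℤ^d → ℝ` as an edge function. -/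
def dgradE (d : ℕ) (h : Vert d → ℝ) : Vert d → Fin d → ℝ :=
  fun x i => h (x + unitv d i) - h x

/-- The inner product `⟨u,w⟩_{ℓ²(E(Λ), c_ω)}` of (antisymmetric) edge functions;
each unordered edge is counted once, which agrees with the paper's sum over
ordered edges carrying the factor ½. -/
def einner (d : ℕ) (ω : EnvSp d) (Λ : Finset (Vert d)) (u w : Vert d → Fin d → ℝ) : ℝ :=
  ∑ e ∈ edgesIn d Λ, u e.1 e.2 * w e.1 e.2 * ω.1 e

/-- The Dirichlet energy `𝓔_Λ^ω(v)`. -/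
def direnergy (d : ℕ) (ω : EnvSp d) (Λ : Finset (Vert d)) (v : EnvSp d → Fin d → ℝ) : ℝ :=
  sInf {r | ∃ h : Vert d → ℝ, (∀ x ∉ Λ, h x = 0) ∧
      r = einner d ω Λ (fun x i => efield d v ω x i - dgradE d h x i)
            (fun x i => efield d v ω x i - dgradE d h x i)}

/-- The gradient `∇h` of a function on `Ω`. -/
def gradOmega (d : ℕ) (h : EnvSp d → ℝ) : EnvSp d → Fin d → ℝ :=
  fun ω i => h (shift d (unitv d i) ω) - h ω

/-- The inner product `⟨u, c w⟩_{L²(P,ℝ^d)}`. -/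
def cinnerP (d : ℕ) (P : Measure (EnvSp d)) (u w : EnvSp d → Fin d → ℝ) : ℝ :=
  ∑ i, ∫ ω', cnd d ω' 0 (unitv d i) * u ω' i * w ω' i ∂P

/-- Bounded vector fields on `Ω`. -/
def IsBddV (d : ℕ) (v : EnvSp d → Fin d → ℝ) : Prop := ∃ M, ∀ ω i, |v ω i| ≤ M

/-- The space `𝒱 = (ℝ^d)^{ℤ^d}` of vector fields on `ℤ^d`. -/
abbrev VS (d : ℕ) := Vert d → Fin d → ℝ

/-- The empirical measures `μ_r^{ω,v}` built from the minimizers `h_r` of the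
finite-volume Dirichlet energies. -/
def muR (d : ℕ) (ω : EnvSp d) (hr : ℕ → Vert d → ℝ) (r : ℕ) :
    Measure (EnvSp d × VS d) :=
  (((box d ((r : ℝ) + Real.sqrt r)).card : ℝ≥0∞) *
      ((box d (Real.sqrt r)).card : ℝ≥0∞))⁻¹ •
    ∑ z ∈ box d (Real.sqrt r), ∑ x ∈ box d ((r : ℝ) + Real.sqrt r),
      Measure.dirac (shift d (x + z) ω, fun y => dgradE d (hr r) (x + z + y))

/-- The localized conductances `c_ω^R`. -/
def cR (d : ℕ) (ω : EnvSp d) (R : ℝ) (e : EdgeIx d) : ℝ :=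
  if e ∈ edgesIn d (box d (2 * R)) then ω.1 e else 1

/-- The localized measure `π_ω^R`. -/
def piRloc (d : ℕ) (ω : EnvSp d) (R : ℝ) (x : Vert d) : ℝ :=
  if x ∈ box d (2 * R) then piOf d ω x
  else if x ∈ box d (4 * R) then 1 + piOf d ω x else 1

/-- The localized Dirichlet form `D_ω^R(f,f)` (each unordered edge counted once). -/
def DR (d : ℕ) (ω : EnvSp d) (R : ℝ) (f : Vert d → ℝ) : ℝ≥0∞ :=
  ∑' e : EdgeIx d, ENNReal.ofReal (cR d ω R e * (f (e.1 + unitv d e.2) - f e.1) ^ 2)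

/-- The norm `‖f‖_{ℓ^s(μ)}`. -/
def lpN (d : ℕ) (μw : Vert d → ℝ) (s : ℝ) (f : Vert d → ℝ) : ℝ≥0∞ :=
  (∑' x : Vert d, ENNReal.ofReal (|f x| ^ s * μw x)) ^ (1 / s)

/-- The exponent `ε = 2(2/d − 1/p − 1/q)((d−2)/d + 1/q)⁻¹`. -/
def epsPQ (d : ℕ) (p q : ℝ) : ℝ :=
  2 * (2 / (d : ℝ) - 1 / p - 1 / q) / (((d : ℝ) - 2) / (d : ℝ) + 1 / q)

/-- Jump rates of the localized constant-speed chain `Y^R`: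
rate `c_ω^R(x,y)/π_ω^R(x)` from `x` to `y`. -/
def rateR (d : ℕ) (ω : EnvSp d) (R : ℝ) (x y : Vert d) : ℝ :=
  (∑ i, ((if y = x + unitv d i then cR d ω R (x, i) else 0) +
         (if x = y + unitv d i then cR d ω R (y, i) else 0))) / piRloc d ω R x

/-- The generator matrix of `Y^R`. -/
def qmatR (d : ℕ) (ω : EnvSp d) (R : ℝ) (x y : Vert d) : ℝ :=
  if x = y then -(∑ z ∈ nbrs d x, rateR d ω R x z) else rateR d ω R x y

/-- Iterates of the generator matrix of `Y^R`. -/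
def qiter (d : ℕ) (ω : EnvSp d) (R : ℝ) : ℕ → Vert d → Vert d → ℝ
  | 0, x, y => if x = y then 1 else 0
  | n+1, x, y => ∑ z ∈ insert x (nbrs d x), qmatR d ω R x z * qiter d ω R n z y

/-- The heat kernel `P_ω^x(Y_t^R = y) = (e^{tQ})(x,y)` of the localized chain `Y^R`. -/
def hkR (d : ℕ) (ω : EnvSp d) (R : ℝ) (t : ℝ) (x y : Vert d) : ℝ :=
  ∑' k : ℕ, t ^ k / (Nat.factorial k : ℝ) * qiter d ω R k x y

/-- A discrete gradient is curl-free on every elementary plaquette. -/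
lemma dgradE_curl_free (d : ℕ) (h : Vert d → ℝ) (x : Vert d) (i j : Fin d) :
    dgradE d h (x + 0) i + dgradE d h (x + unitv d i) j =
      dgradE d h (x + 0) j + dgradE d h (x + unitv d j) i := by
  simp only [dgradE, add_zero]
  rw [add_right_comm x (unitv d i) (unitv d j)]
  ring

lemma box_card_ne_zero (d : ℕ) {r : ℝ} (hr : 0 ≤ r) : (box d r).card ≠ 0 := by
  have h : (0 : Vert d) ∈ box d r := by
    simp only [box, Fintype.mem_piFinset, Finset.mem_Icc, Pi.zero_apply]
    exact fun _ => ⟨Int.ceil_le.2 (by simpa using hr), Int.le_floor.2 (by simpa using hr)⟩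
  exact Finset.card_ne_zero_of_mem h

instance isProbabilityMeasure_muR (d : ℕ) (ω : EnvSp d) (hr : ℕ → Vert d → ℝ) (r : ℕ) :
    IsProbabilityMeasure (muR d ω hr r) := by
  have h₁ := box_card_ne_zero d (r := (r : ℝ) + Real.sqrt r) (by positivity)
  have h₂ := box_card_ne_zero d (r := Real.sqrt r) (by positivity)
  constructor
  simp only [muR, Measure.smul_apply, Measure.coe_finsetSum, Finset.sum_apply, measure_univ,
    Finset.sum_const, smul_eq_mul, nsmul_eq_mul, mul_one]
  rw [mul_comm ((box d (Real.sqrt r)).card : ℝ≥0∞)]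
  exact ENNReal.inv_mul_cancel (mul_ne_zero (by exact_mod_cast h₁) (by exact_mod_cast h₂))
    (ENNReal.mul_ne_top (ENNReal.natCast_ne_top _) (ENNReal.natCast_ne_top _))

/-- A property shared by all atoms of the empirical measure holds almost everywhere. -/
lemma ae_muR (d : ℕ) (ω : EnvSp d) (hr : ℕ → Vert d → ℝ) (r : ℕ) {A : Set (EnvSp d × VS d)}
    (hA : MeasurableSet A)
    (h : ∀ x : Vert d, (shift d x ω, fun y => dgradE d (hr r) (x + y)) ∈ A) :
    ∀ᵐ pr ∂(muR d ω hr r), pr ∈ A := by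
  rw [ae_iff]
  change muR d ω hr r Aᶜ = 0
  simp only [muR, Measure.smul_apply, Measure.coe_finsetSum, Finset.sum_apply, smul_eq_mul]
  rw [Finset.sum_eq_zero, mul_zero]
  intro z _
  refine Finset.sum_eq_zero fun x _ => ?_
  rw [Measure.dirac_apply' _ hA.compl]
  simp [h (x + z)]

/-- The curl of a vector field on the plaquette spanned by `e i` and `e j` at the origin. -/
def curlAt (d : ℕ) (i j : Fin d) (pr : EnvSp d × VS d) : ℝ :=
  pr.2 0 i + pr.2 (unitv d i) j - (pr.2 0 j + pr.2 (unitv d j) i)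

lemma continuous_curlAt (d : ℕ) (i j : Fin d) : Continuous (curlAt d i j) := by
  unfold curlAt
  fun_prop

/-- The curl truncated to `[0, 1]`. -/
def truncCurl (d : ℕ) (i j : Fin d) : BoundedContinuousFunction (EnvSp d × VS d) ℝ :=
  BoundedContinuousFunction.ofNormedAddCommGroup (fun pr => min |curlAt d i j pr| 1)
    ((continuous_curlAt d i j).abs.min continuous_const) 1 fun pr => by
      rw [Real.norm_of_nonneg (le_min (abs_nonneg _) zero_le_one)]
      exact min_le_right _ _

lemma truncCurl_nonneg (d : ℕ) (i j : Fin d) (pr : EnvSp d × VS d) : 0 ≤ truncCurl d i j pr :=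
  le_min (abs_nonneg _) zero_le_one

lemma truncCurl_eq_zero_iff (d : ℕ) (i j : Fin d) (pr : EnvSp d × VS d) :
    truncCurl d i j pr = 0 ↔ curlAt d i j pr = 0 := by
  change min |curlAt d i j pr| 1 = 0 ↔ _
  constructor
  · intro h
    rcases min_choice |curlAt d i j pr| 1 with h' | h' <;> rw [h'] at h
    · exact abs_eq_zero.1 h
    · exact absurd h one_ne_zero
  · intro h
    simp [h]

lemma integral_truncCurl_muR (d : ℕ) (ω : EnvSp d) (hr : ℕ → Vert d → ℝ) (r : ℕ) (i j : Fin d) :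
    ∫ pr, truncCurl d i j pr ∂(muR d ω hr r) = 0 := by
  have h := ae_muR d ω hr r (A := {pr | curlAt d i j pr = 0})
    ((continuous_curlAt d i j).measurable (measurableSet_singleton 0))
    fun x => sub_eq_zero.2 (dgradE_curl_free d (hr r) x i j)
  refine integral_eq_zero_of_ae ?_
  filter_upwards [h] with pr hpr
  exact (truncCurl_eq_zero_iff d i j pr).2 hpr

/-- STATEMENT 17 (Corollary 5.8): any subsequential weak limit of `μ_r^{ω,v}` is
supported on curl-free fields. -/
theorem statement17 (d : ℕ) (hd : 1 ≤ d) (v : EnvSp d → Fin d → ℝ)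
    (hv : Continuous v) (hvb : IsBddV d v) (p q : ℝ) (hp : 1 < p) (hq : 1 < q)
    (ω : EnvSp d) (hstar : InOmegaStar d ω) (hmom : InOmegaPQ d p q ω)
    (hr : ℕ → Vert d → ℝ)
    (hmin : ∀ r : ℕ, (∀ x ∉ box d (r : ℝ), hr r x = 0) ∧
        einner d ω (box d (r : ℝ))
            (fun x i => efield d v ω x i - dgradE d (hr r) x i)
            (fun x i => efield d v ω x i - dgradE d (hr r) x i) =
          direnergy d ω (box d (r : ℝ)) v)
    (φ : ℕ → ℕ) (hφ : StrictMono φ) (μ : Measure (EnvSp d × VS d))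
    (hlim : ∀ F : BoundedContinuousFunction (EnvSp d × VS d) ℝ,
        Tendsto (fun k : ℕ => ∫ pr, F pr ∂(muR d ω hr (φ k))) atTop
          (𝓝 (∫ pr, F pr ∂μ))) :
    μ {pr : EnvSp d × VS d | ∀ i j : Fin d, i < j →
        pr.2 0 i + pr.2 (unitv d i) j = pr.2 0 j + pr.2 (unitv d j) i} = 1 := by
  have hprob : IsProbabilityMeasure μ := by
    have h := hlim (BoundedContinuousFunction.const _ 1)
    simp only [BoundedContinuousFunction.const_apply, integral_const, smul_eq_mul, mul_one,
      probReal_univ] at h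
    have h1 : μ.real Set.univ = 1 := tendsto_nhds_unique h tendsto_const_nhds
    refine ⟨?_⟩
    rwa [measureReal_def, ENNReal.toReal_eq_one_iff] at h1
  have hcurl : ∀ i j : Fin d, ∀ᵐ pr ∂μ, curlAt d i j pr = 0 := by
    intro i j
    have h := hlim (truncCurl d i j)
    simp only [integral_truncCurl_muR] at h
    have h0 : ∫ pr, truncCurl d i j pr ∂μ = 0 := tendsto_nhds_unique h tendsto_const_nhds
    have hae := (integral_eq_zero_iff_of_nonneg (truncCurl_nonneg d i j)
      ((truncCurl d i j).integrable μ)).1 h0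
    filter_upwards [hae] with pr hpr
    exact (truncCurl_eq_zero_iff d i j pr).1 hpr
  have hall : ∀ᵐ pr ∂μ, ∀ i j : Fin d, i < j →
      pr.2 0 i + pr.2 (unitv d i) j = pr.2 0 j + pr.2 (unitv d j) i := by
    filter_upwards [ae_all_iff.2 fun i => ae_all_iff.2 (hcurl i)] with pr hpr i j _
    exact sub_eq_zero.1 (hpr i j)
  exact (measure_congr (eventuallyEq_univ.2 hall)).trans measure_univ


end DetCond
end
end

section
/- Let d ≥ 2 and fix p,q ∈ (d/2,∞) satisfying 1/p + 1/q < 2/d. Then ε := 2(2/d − 1/p − 1/q)((d−2)/d + 1/q)^{-1} satisfies 0 < ε, with ε < 4/(d−2) when d ≥ 3, and for each ω ∈ Ω_{p,q} there is c₁(ω) ∈ (0,∞) such that for every R ≥ 1 and every f ∈ ℓ²(π_ω^R), ‖f‖²_{ℓ^{2+ε}(π_ω^R)} ≤ c₁(ω) ( R^{2 − dε/(2+ε)} D_ω^R(f,f) + R^{−dε/(2+ε)} ‖f‖²_{ℓ²(π_ω^R)} ). -/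
open MeasureTheory Filter Topology Matrix
open scoped ENNReal NNReal

noncomputable section

namespace DetCond

/-- Hölder's inequality for sums over a countable type, with the exponents outside. -/
theorem tsum_rpow_mul_rpow_le {ι : Type*} [Countable ι] (f g : ι → ℝ≥0∞) {p q : ℝ}
    (hp : 0 ≤ p) (hq : 0 ≤ q) (hpq : p + q = 1) :
    ∑' i, f i ^ p * g i ^ q ≤ (∑' i, f i) ^ p * (∑' i, g i) ^ q := by
  let _ : MeasurableSpace ι := ⊤
  have h := ENNReal.lintegral_mul_norm_pow_le (μ := Measure.count) (f := f) (g := g)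
    (measurable_of_countable f).aemeasurable (measurable_of_countable g).aemeasurable hp hq hpq
  simpa only [lintegral_count] using h

theorem tsum_rpow_le_of_le_one {ι : Type*} (f : ι → ℝ≥0∞) {r : ℝ} (h0 : 0 < r) (h1 : r ≤ 1) :
    (∑' i, f i) ^ r ≤ ∑' i, f i ^ r := by
  have key : ∀ s : Finset ι, (∑ i ∈ s, f i) ^ r ≤ ∑ i ∈ s, f i ^ r := by
    classical
    intro s
    induction s using Finset.induction_on with
    | empty => simp [h0]
    | insert a s ha ih =>
      rw [Finset.sum_insert ha, Finset.sum_insert ha]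
      exact (ENNReal.rpow_add_le_add_rpow _ _ h0.le h1).trans (by gcongr)
  refine le_of_tendsto
    (((ENNReal.continuous_rpow_const (y := r)).tendsto _).comp
      (ENNReal.summable (f := f)).hasSum) ?_
  exact Eventually.of_forall fun s => (key s).trans (ENNReal.sum_le_tsum s)

theorem lintegral_pi_count {ι : Type*} [Fintype ι] (f : (ι → ℤ) → ℝ≥0∞) :
    ∫⁻ x, f x ∂(Measure.pi fun _ : ι => (Measure.count : Measure ℤ)) = ∑' x, f x := by
  have : Measure.pi (fun _ : ι => (Measure.count : Measure ℤ)) = Measure.count :=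
    Measure.ext_of_singleton fun x => by simp [Measure.pi_singleton]
  rw [this, lintegral_count]

theorem enorm_le_tsum_enorm_sub {v : ℤ → ℝ} (hv : v.support.Finite) (n : ℤ) :
    ‖v n‖ₑ ≤ ∑' t : ℤ, ‖v (t + 1) - v t‖ₑ := by
  have hinj : Function.Injective fun k : ℕ => n + (k : ℤ) := fun a b h => by simpa using h
  obtain ⟨N, hN⟩ : ∃ N : ℕ, v (n + N) = 0 := by
    by_contra! h
    exact (Set.infinite_range_of_injective hinj) (hv.subset (by rintro _ ⟨k, rfl⟩; exact h k))
  have h1 : v n = -∑ k ∈ Finset.range N, (v (n + k + 1) - v (n + k)) := by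
    have h2 := Finset.sum_range_sub (fun k : ℕ => v (n + k)) N
    simp only [Nat.cast_add, Nat.cast_one, ← add_assoc] at h2
    rw [h2, hN]; simp
  calc ‖v n‖ₑ ≤ ∑ k ∈ Finset.range N, ‖v (n + k + 1) - v (n + k)‖ₑ := by
        rw [h1, enorm_neg]; exact enorm_sum_le _ _
    _ ≤ ∑' k : ℕ, ‖v (n + k + 1) - v (n + k)‖ₑ := ENNReal.sum_le_tsum _
    _ ≤ _ := ENNReal.tsum_comp_le_tsum_of_injective hinj fun t : ℤ => ‖v (t + 1) - v t‖ₑ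

theorem update_add_one (d : ℕ) (x : Vert d) (i : Fin d) (t : ℤ) :
    Function.update x i (t + 1) = Function.update x i t + unitv d i := by
  funext j
  by_cases h : j = i
  · subst h; simp [unitv]
  · simp [unitv, h]

/-- The discrete isoperimetric (`L¹`) Sobolev inequality on `ℤ^d`. -/
theorem tsum_rpow_le_tsum_grad {d : ℕ} (hd : 2 ≤ d) {u : Vert d → ℝ} (hu : u.support.Finite) :
    ∑' x, ‖u x‖ₑ ^ ((d : ℝ) / (d - 1)) ≤
      (∑' x, ∑ i, ‖u (x + unitv d i) - u x‖ₑ) ^ ((d : ℝ) / (d - 1)) := by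
  have hd' : (2 : ℝ) ≤ d := by exact_mod_cast hd
  set F : Vert d → ℝ≥0∞ := fun x => ∑ i, ‖u (x + unitv d i) - u x‖ₑ with hF
  have hconj : Real.HolderConjugate (Fintype.card (Fin d) : ℝ) ((d : ℝ) / (d - 1)) := by
    rw [Fintype.card_fin]
    exact Real.HolderConjugate.conjExponent (by linarith)
  have h := lintegral_prod_lintegral_pow_le (fun _ : Fin d => (Measure.count : Measure ℤ)) hconj
    (measurable_of_countable F)
  rw [lintegral_pi_count, lintegral_pi_count] at h
  refine le_trans (ENNReal.tsum_le_tsum fun x => ?_) h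
  have hline : ∀ i : Fin d, ‖u x‖ₑ ≤ ∫⁻ t, F (Function.update x i t) ∂Measure.count := by
    intro i
    rw [lintegral_count]
    have hv : (Function.support fun t : ℤ => u (Function.update x i t)).Finite :=
      hu.preimage (f := fun t : ℤ => Function.update x i t)
        (Function.update_injective x i).injOn
    have h1 := enorm_le_tsum_enorm_sub hv (x i)
    simp only [Function.update_eq_self, update_add_one] at h1
    refine h1.trans (ENNReal.tsum_le_tsum fun t => ?_)
    exact Finset.single_le_sum (f := fun j => ‖u (Function.update x i t + unitv d j) -
      u (Function.update x i t)‖ₑ) (fun _ _ => zero_le) (Finset.mem_univ i)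
  calc ‖u x‖ₑ ^ ((d : ℝ) / (d - 1)) = ∏ _i : Fin d, ‖u x‖ₑ ^ ((1 : ℝ) / (d - 1)) := by
        rw [Finset.prod_const, Finset.card_univ, Fintype.card_fin, ← ENNReal.rpow_natCast,
          ← ENNReal.rpow_mul]
        congr 1; ring
    _ ≤ _ := by
        rw [Fintype.card_fin]
        exact Finset.prod_le_prod' fun i _ =>
          ENNReal.rpow_le_rpow (hline i) (by apply div_nonneg <;> linarith)

theorem abs_rpow_sub_rpow_le {γ : ℝ} (hγ : 1 ≤ γ) {s t : ℝ} (hs : 0 ≤ s) (ht : 0 ≤ t) :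
    |s ^ γ - t ^ γ| ≤ γ * (|s - t| * (s ^ (γ - 1) + t ^ (γ - 1))) := by
  wlog hst : s ≤ t generalizing s t
  · have := this ht hs (le_of_not_ge hst)
    rwa [abs_sub_comm, abs_sub_comm t s, add_comm] at this
  have h := Convex.norm_image_sub_le_of_norm_deriv_le (f := fun x : ℝ => x ^ γ)
    (s := Set.Icc 0 t) (C := γ * t ^ (γ - 1)) (x := s) (y := t)
    (fun x _ => (Real.hasDerivAt_rpow_const (Or.inr hγ)).differentiableAt) (fun x hx => by
      rw [(Real.hasDerivAt_rpow_const (Or.inr hγ)).deriv, Real.norm_eq_abs, abs_of_nonneg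
        (mul_nonneg (by linarith) (Real.rpow_nonneg hx.1 _))]
      exact mul_le_mul_of_nonneg_left (Real.rpow_le_rpow hx.1 hx.2 (by linarith)) (by linarith))
    (convex_Icc 0 t) ⟨hs, hst⟩ ⟨ht, le_rfl⟩
  rw [Real.norm_eq_abs, Real.norm_eq_abs, abs_sub_comm, abs_sub_comm t s] at h
  refine h.trans ?_
  rw [mul_assoc, mul_comm (t ^ (γ - 1))]
  have := Real.rpow_nonneg hs (γ - 1)
  gcongr
  linarith

theorem enorm_abs_rpow (r : ℝ) {γ : ℝ} (hγ : 0 ≤ γ) : ‖|r| ^ γ‖ₑ = ‖r‖ₑ ^ γ := by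
  rw [Real.enorm_eq_ofReal (by positivity), Real.enorm_eq_ofReal_abs,
    ENNReal.ofReal_rpow_of_nonneg (abs_nonneg r) hγ]

/-- The discrete Gagliardo–Nirenberg–Sobolev inequality on `ℤ^d`. -/
theorem tsum_rpow_le_tsum_grad_rpow {d : ℕ} (hd : 2 ≤ d) {a b : ℝ} (ha : 1 < a) (hb : 0 < b)
    (hab : 1 / b = 1 / a - 1 / (d : ℝ)) {u : Vert d → ℝ} (hu : u.support.Finite) :
    (∑' x, ‖u x‖ₑ ^ b) ^ (1 / b) ≤
      ENNReal.ofReal (2 * d * (b * (d - 1) / d)) *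
        (∑' x, ∑ i, ‖u (x + unitv d i) - u x‖ₑ ^ a) ^ (1 / a) := by
  have hd' : (2 : ℝ) ≤ d := by exact_mod_cast hd
  have ha0 : 0 < a := by linarith
  have hd0 : (d : ℝ) ≠ 0 := by positivity
  set γ : ℝ := b * (d - 1) / d with hγdef
  have hγb : γ - 1 = b * (1 - 1 / a) := by
    have h1 : 1 / a = 1 / b + 1 / (d : ℝ) := by linarith
    rw [h1, hγdef]
    field_simp
    ring
  have h1a : 0 < 1 - 1 / a := by
    rw [sub_pos, div_lt_one ha0]; exact ha
  have hγ : 1 ≤ γ := by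
    have := mul_pos hb h1a
    linarith
  set X : ℝ≥0∞ := ∑' x, ‖u x‖ₑ ^ b with hX
  set Y : ℝ≥0∞ := ∑' x, ∑ i, ‖u (x + unitv d i) - u x‖ₑ ^ a with hY
  have hXtop : X ≠ ⊤ := by
    have : X = ∑ x ∈ hu.toFinset, ‖u x‖ₑ ^ b := by
      rw [hX]
      refine tsum_eq_sum fun x hx => ?_
      have : u x = 0 := by simpa using hx
      simp [this, hb]
    rw [this]
    exact ENNReal.sum_ne_top.2 fun x _ => ENNReal.rpow_ne_top_of_nonneg hb.le enorm_ne_top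
  have hw : (Function.support fun x => |u x| ^ γ).Finite := by
    refine hu.subset fun x hx hx0 => hx ?_
    have : u x = 0 := hx0
    simp [this, Real.zero_rpow (by linarith : γ ≠ 0)]
  have hL1 := tsum_rpow_le_tsum_grad hd hw
  have hXeq : ∑' x, ‖|u x| ^ γ‖ₑ ^ ((d : ℝ) / (d - 1)) = X := by
    refine tsum_congr fun x => ?_
    rw [enorm_abs_rpow _ (by linarith), ← ENNReal.rpow_mul]
    congr 1
    have : (d : ℝ) - 1 ≠ 0 := by linarith
    rw [hγdef]; field_simp
  rw [hXeq] at hL1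
  have hHolder : ∀ (i : Fin d) (v : Vert d → ℝ), ∑' x, ‖v x‖ₑ ^ b = X →
      ∑' x, ‖u (x + unitv d i) - u x‖ₑ * ‖v x‖ₑ ^ (γ - 1) ≤ Y ^ (1 / a) * X ^ (1 - 1 / a) := by
    intro i v hv
    have h1 := tsum_rpow_mul_rpow_le (fun x => ‖u (x + unitv d i) - u x‖ₑ ^ a)
      (fun x => ‖v x‖ₑ ^ b) (p := 1 / a) (q := 1 - 1 / a) (by positivity) h1a.le (by ring)
    simp only [← ENNReal.rpow_mul, mul_one_div_cancel ha0.ne', ENNReal.rpow_one, ← hγb, hv] at h1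
    refine h1.trans ?_
    gcongr
    refine ENNReal.tsum_le_tsum fun x => ?_
    exact Finset.single_le_sum (f := fun i => ‖u (x + unitv d i) - u x‖ₑ ^ a)
      (fun _ _ => zero_le) (Finset.mem_univ i)
  have hgrad : ∑' x, ∑ i, ‖|u (x + unitv d i)| ^ γ - |u x| ^ γ‖ₑ ≤
      ENNReal.ofReal (2 * d * γ) * Y ^ (1 / a) * X ^ (1 - 1 / a) := by
    have hpt : ∀ x i, ‖|u (x + unitv d i)| ^ γ - |u x| ^ γ‖ₑ ≤ ENNReal.ofReal γ *
        (‖u (x + unitv d i) - u x‖ₑ * ‖u (x + unitv d i)‖ₑ ^ (γ - 1) +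
          ‖u (x + unitv d i) - u x‖ₑ * ‖u x‖ₑ ^ (γ - 1)) := by
      intro x i
      rw [← mul_add, ← enorm_abs_rpow _ (by linarith), ← enorm_abs_rpow _ (by linarith),
        Real.enorm_eq_ofReal_abs, Real.enorm_eq_ofReal_abs,
        Real.enorm_eq_ofReal (by positivity), Real.enorm_eq_ofReal (by positivity),
        ← ENNReal.ofReal_add (by positivity) (by positivity),
        ← ENNReal.ofReal_mul (by positivity), ← ENNReal.ofReal_mul (by positivity)]
      refine ENNReal.ofReal_le_ofReal
        ((abs_rpow_sub_rpow_le hγ (abs_nonneg _) (abs_nonneg _)).trans ?_)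
      gcongr γ * (?_ * _)
      exact abs_abs_sub_abs_le_abs_sub _ _
    calc _ ≤ ∑' x, ∑ i, ENNReal.ofReal γ *
        (‖u (x + unitv d i) - u x‖ₑ * ‖u (x + unitv d i)‖ₑ ^ (γ - 1) +
          ‖u (x + unitv d i) - u x‖ₑ * ‖u x‖ₑ ^ (γ - 1)) :=
          ENNReal.tsum_le_tsum fun x => Finset.sum_le_sum fun i _ => hpt x i
      _ = ∑ i, ENNReal.ofReal γ *
        (∑' x, ‖u (x + unitv d i) - u x‖ₑ * ‖u (x + unitv d i)‖ₑ ^ (γ - 1) +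
          ∑' x, ‖u (x + unitv d i) - u x‖ₑ * ‖u x‖ₑ ^ (γ - 1)) := by
          rw [Summable.tsum_finsetSum fun i _ => ENNReal.summable]
          refine Finset.sum_congr rfl fun i _ => ?_
          rw [ENNReal.tsum_mul_left, ENNReal.tsum_add]
      _ ≤ ∑ _i : Fin d, ENNReal.ofReal γ *
          (Y ^ (1 / a) * X ^ (1 - 1 / a) + Y ^ (1 / a) * X ^ (1 - 1 / a)) := by
          gcongr with i
          · exact hHolder i (fun x => u (x + unitv d i))
              ((Equiv.addRight (unitv d i)).tsum_eq fun x => ‖u x‖ₑ ^ b)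
          · exact hHolder i u rfl
      _ = _ := by
          rw [Finset.sum_const, Finset.card_univ, Fintype.card_fin, nsmul_eq_mul, ← two_mul,
            ENNReal.ofReal_mul (by positivity), ENNReal.ofReal_mul (by positivity),
            ENNReal.ofReal_natCast, ENNReal.ofReal_ofNat]
          ring
  have hmain : X ^ (1 / b) * X ^ (1 - 1 / a) ≤
      ENNReal.ofReal (2 * d * γ) * Y ^ (1 / a) * X ^ (1 - 1 / a) := by
    refine le_trans ?_ hgrad
    rw [← ENNReal.rpow_add_of_nonneg _ _ (by positivity) h1a.le]
    have he : 1 / b + (1 - 1 / a) = ((d : ℝ) / (d - 1))⁻¹ := by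
      rw [hab, inv_div]; field_simp; ring
    rw [he, ENNReal.rpow_inv_le_iff (by apply div_pos <;> linarith)]
    exact hL1
  by_cases hX0 : X = 0
  · simp [hX0, hb]
  · exact (ENNReal.mul_le_mul_iff_left
      (ENNReal.rpow_pos (pos_iff_ne_zero.2 hX0) hXtop).ne'
      (ENNReal.rpow_ne_top_of_nonneg h1a.le hXtop)).1 hmain

theorem sum_rpow_mul_rpow_le {ι : Type*} (s : Finset ι) (f g : ι → ℝ≥0∞) {p q : ℝ}
    (hp : 0 ≤ p) (hq : 0 ≤ q) (hpq : p + q = 1) :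
    ∑ i ∈ s, f i ^ p * g i ^ q ≤ (∑ i ∈ s, f i) ^ p * (∑ i ∈ s, g i) ^ q := by
  have h := tsum_rpow_mul_rpow_le (fun i : s => f i) (fun i : s => g i) hp hq hpq
  rwa [Finset.tsum_subtype s f, Finset.tsum_subtype s g,
    Finset.tsum_subtype s fun i => f i ^ p * g i ^ q] at h

theorem ennreal_add_sq_le (x y : ℝ≥0∞) : (x + y) ^ 2 ≤ 2 * (x ^ 2 + y ^ 2) := by
  have h := ENNReal.rpow_add_le_mul_rpow_add_rpow x y (p := 2) (by norm_num)
  norm_num at h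
  exact h

/-- A weighted Sobolev inequality localized by a cutoff function `η` supported in `S`. -/
theorem weighted_sobolev_of_cutoff {d : ℕ} (hd : 2 ≤ d) {p q s b : ℝ} (hp : 1 < p) (hq : 1 < q)
    (hs : 0 < s) (hb : 0 < b) (hbq : 1 / b = (q + 1) / (2 * q) - 1 / (d : ℝ))
    (hbs : b * (1 - 1 / p) = s)
    {c : Vert d → Fin d → ℝ≥0∞} {m : Vert d → ℝ≥0∞}
    (hc0 : ∀ x i, c x i ≠ 0) (hctop : ∀ x i, c x i ≠ ⊤) (hcm : ∀ x i, c x i ≤ m x)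
    (f η : Vert d → ℝ) {S B : Finset (Vert d)} {δ M : ℝ≥0∞}
    (hηB : ∀ x ∈ B, η x = 1) (hη1 : ∀ x, ‖η x‖ₑ ≤ 1)
    (hηS : ∀ x ∉ S, η x = 0 ∧ ∀ i, η (x + unitv d i) = 0)
    (hηδ : ∀ x i, ‖η (x + unitv d i) - η x‖ₑ ≤ δ)
    (hmM : ∑ x ∈ S, m x ^ p ≤ M) (hcM : ∑ x ∈ S, ∑ i, c x i ^ (-q) ≤ M) :
    (∑ x ∈ B, ‖f x‖ₑ ^ s * m x) ^ (2 / s) ≤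
      ENNReal.ofReal (2 * d * (b * (d - 1) / d)) ^ 2 * M ^ (2 / (s * p) + 1 / q) *
        (2 * ∑ x ∈ S, (∑ i, c x i * ‖f (x + unitv d i) - f x‖ₑ ^ 2 +
          d * (δ ^ 2 * (‖f x‖ₑ ^ 2 * m x)))) := by
  set u : Vert d → ℝ := fun x => η x * f x with hu_def
  set K := ENNReal.ofReal (2 * d * (b * (d - 1) / d)) with hK
  set a : ℝ := 2 * q / (q + 1) with ha_def
  have hq0 : 0 < q := by linarith
  have hp0 : 0 < p := by linarith
  have ha : 1 < a := by rw [ha_def, lt_div_iff₀ (by linarith)]; linarith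
  have ha0 : 0 < a := by linarith
  have h1p : 0 < 1 - 1 / p := by rw [sub_pos, div_lt_one hp0]; exact hp
  have hu : u.support.Finite := by
    refine S.finite_toSet.subset fun x hx => ?_
    by_contra hxS
    exact hx (by simp [hu_def, (hηS x hxS).1])
  have hBS : B ⊆ S := by
    intro x hx
    by_contra hxS
    have h1 := hηB x hx
    rw [(hηS x hxS).1] at h1
    exact zero_ne_one h1
  set X : ℝ≥0∞ := ∑' x, ‖u x‖ₑ ^ b with hX
  set Y : ℝ≥0∞ := ∑' x, ∑ i, ‖u (x + unitv d i) - u x‖ₑ ^ a with hY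
  set G : Vert d → Fin d → ℝ≥0∞ := fun x i => ‖f (x + unitv d i) - f x‖ₑ + δ * ‖f x‖ₑ with hG
  have hsob : X ^ (1 / b) ≤ K * Y ^ (1 / a) :=
    tsum_rpow_le_tsum_grad_rpow hd ha hb (by rw [hbq, ha_def, one_div_div]) hu
  have hleft : ∑ x ∈ B, ‖f x‖ₑ ^ s * m x ≤ X ^ (1 - 1 / p) * M ^ (1 / p) := by
    have h1 := sum_rpow_mul_rpow_le B (fun x => ‖u x‖ₑ ^ b) (fun x => m x ^ p)
      (p := 1 - 1 / p) (q := 1 / p) h1p.le (by positivity) (by ring)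
    simp only [← ENNReal.rpow_mul, hbs, mul_one_div_cancel hp0.ne', ENNReal.rpow_one] at h1
    calc ∑ x ∈ B, ‖f x‖ₑ ^ s * m x = ∑ x ∈ B, ‖u x‖ₑ ^ s * m x :=
          Finset.sum_congr rfl fun x hx => by simp [hu_def, hηB x hx]
      _ ≤ _ := h1
      _ ≤ _ := by
          gcongr
          · exact ENNReal.sum_le_tsum B
          · exact (Finset.sum_le_sum_of_subset hBS).trans hmM
  have hgradu : ∀ x i, ‖u (x + unitv d i) - u x‖ₑ ≤ G x i := by
    intro x i
    have h1 : u (x + unitv d i) - u x =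
        η (x + unitv d i) * (f (x + unitv d i) - f x) + (η (x + unitv d i) - η x) * f x := by
      simp only [hu_def]; ring
    rw [h1]
    refine (enorm_add_le _ _).trans ?_
    rw [enorm_mul, enorm_mul]
    refine add_le_add (mul_le_of_le_one_left' (hη1 _)) ?_
    gcongr
    exact hηδ x i
  have hYle : Y ≤ (∑ x ∈ S, ∑ i, c x i * G x i ^ 2) ^ (a / 2) * M ^ (1 - a / 2) := by
    have ha2 : 0 ≤ 1 - a / 2 := by
      have : a / 2 = q / (q + 1) := by rw [ha_def]; field_simp
      rw [this, sub_nonneg, div_le_one (by linarith)]; linarith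
    have hqa : -q * (1 - a / 2) = -(a / 2) := by rw [ha_def]; field_simp; ring
    have h1 := sum_rpow_mul_rpow_le (S ×ˢ (Finset.univ : Finset (Fin d)))
      (fun e => c e.1 e.2 * G e.1 e.2 ^ 2) (fun e => c e.1 e.2 ^ (-q))
      (p := a / 2) (q := 1 - a / 2) (by positivity) ha2 (by ring)
    simp only [Finset.sum_product] at h1
    have h2 : Y = ∑ x ∈ S, ∑ i, ‖u (x + unitv d i) - u x‖ₑ ^ a := by
      refine tsum_eq_sum fun x hx => Finset.sum_eq_zero fun i _ => ?_
      simp [hu_def, (hηS x hx).1, (hηS x hx).2 i, ha0]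
    rw [h2]
    calc _ ≤ ∑ x ∈ S, ∑ i, (c x i * G x i ^ 2) ^ (a / 2) * (c x i ^ (-q)) ^ (1 - a / 2) := by
          gcongr with x _ i _
          rw [ENNReal.mul_rpow_of_nonneg _ _ (by positivity), ← ENNReal.rpow_mul, hqa,
            mul_right_comm, ← ENNReal.rpow_add _ _ (hc0 x i) (hctop x i), add_neg_cancel,
            ENNReal.rpow_zero, one_mul, ← ENNReal.rpow_natCast, ← ENNReal.rpow_mul]
          have : ((2 : ℕ) : ℝ) * (a / 2) = a := by push_cast; ring
          rw [this]
          exact ENNReal.rpow_le_rpow (hgradu x i) ha0.le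
      _ ≤ _ := h1
      _ ≤ _ := by gcongr
  have hYpow : Y ^ (2 / a) ≤ (∑ x ∈ S, ∑ i, c x i * G x i ^ 2) * M ^ (1 / q) := by
    refine (ENNReal.rpow_le_rpow hYle (by positivity)).trans_eq ?_
    rw [ENNReal.mul_rpow_of_nonneg _ _ (by positivity), ← ENNReal.rpow_mul, ← ENNReal.rpow_mul]
    have h1 : a / 2 * (2 / a) = 1 := by field_simp
    have h2 : (1 - a / 2) * (2 / a) = 1 / q := by rw [ha_def]; field_simp; ring
    rw [h1, h2, ENNReal.rpow_one]
  have hXpow : X ^ (2 / b) ≤ K ^ 2 * Y ^ (2 / a) := by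
    have h1 : ∀ (Z : ℝ≥0∞) (t : ℝ), Z ^ (2 / t) = (Z ^ (1 / t)) ^ 2 := by
      intro Z t
      rw [← ENNReal.rpow_natCast, ← ENNReal.rpow_mul]
      congr 1; push_cast; ring
    rw [h1, h1, ← mul_pow]
    gcongr
  have hE : ∑ x ∈ S, ∑ i, c x i * G x i ^ 2 ≤
      2 * ∑ x ∈ S, (∑ i, c x i * ‖f (x + unitv d i) - f x‖ₑ ^ 2 +
          d * (δ ^ 2 * (‖f x‖ₑ ^ 2 * m x))) := by
    rw [Finset.mul_sum]
    refine Finset.sum_le_sum fun x _ => ?_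
    have h1 : (d : ℝ≥0∞) * (δ ^ 2 * (‖f x‖ₑ ^ 2 * m x)) =
        ∑ _i : Fin d, δ ^ 2 * (‖f x‖ₑ ^ 2 * m x) := by simp
    rw [h1, ← Finset.sum_add_distrib, Finset.mul_sum]
    refine Finset.sum_le_sum fun i _ => ?_
    calc c x i * G x i ^ 2
        ≤ c x i * (2 * (‖f (x + unitv d i) - f x‖ₑ ^ 2 + (δ * ‖f x‖ₑ) ^ 2)) := by
          gcongr; exact ennreal_add_sq_le _ _
      _ = 2 * (c x i * ‖f (x + unitv d i) - f x‖ₑ ^ 2 + δ ^ 2 * (‖f x‖ₑ ^ 2 * c x i)) := by ring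
      _ ≤ _ := by gcongr; exact hcm x i
  calc (∑ x ∈ B, ‖f x‖ₑ ^ s * m x) ^ (2 / s)
      ≤ (X ^ (1 - 1 / p) * M ^ (1 / p)) ^ (2 / s) := ENNReal.rpow_le_rpow hleft (by positivity)
    _ = X ^ (2 / b) * M ^ (2 / (s * p)) := by
        rw [ENNReal.mul_rpow_of_nonneg _ _ (by positivity), ← ENNReal.rpow_mul,
          ← ENNReal.rpow_mul]
        have h1 : (1 - 1 / p) * (2 / s) = 2 / b := by
          have hp1 : p - 1 ≠ 0 := by linarith
          rw [← hbs]; field_simp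
        have h2 : 1 / p * (2 / s) = 2 / (s * p) := by field_simp
        rw [h1, h2]
    _ ≤ K ^ 2 * ((∑ x ∈ S, ∑ i, c x i * G x i ^ 2) * M ^ (1 / q)) * M ^ (2 / (s * p)) := by
        gcongr
        exact hXpow.trans (by gcongr)
    _ = K ^ 2 * M ^ (2 / (s * p) + 1 / q) * (∑ x ∈ S, ∑ i, c x i * G x i ^ 2) := by
        rw [ENNReal.rpow_add_of_nonneg _ _ (by positivity) (by positivity)]
        ring
    _ ≤ _ := by gcongr

/-- The box of side `2 * r` centred at `z`. -/
def cube (d : ℕ) (z : Vert d) (r : ℤ) : Finset (Vert d) :=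
  Fintype.piFinset fun i => Finset.Icc (z i - r) (z i + r)

theorem mem_cube {d : ℕ} {z : Vert d} {r : ℤ} {x : Vert d} :
    x ∈ cube d z r ↔ ∀ i, z i - r ≤ x i ∧ x i ≤ z i + r := by
  simp [cube]

theorem mem_cube_iff_norm_le {d : ℕ} {z : Vert d} {r : ℤ} (hr : 0 ≤ r) {x : Vert d} :
    x ∈ cube d z r ↔ ‖x - z‖ ≤ r := by
  rw [mem_cube, pi_norm_le_iff_of_nonneg (by exact_mod_cast hr)]
  refine forall_congr' fun i => ?_
  rw [Pi.sub_apply, Int.norm_eq_abs, ← Int.cast_abs, Int.cast_le, abs_le]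
  omega

theorem norm_unitv_le (d : ℕ) (i : Fin d) : ‖unitv d i‖ ≤ 1 := by
  rw [pi_norm_le_iff_of_nonneg zero_le_one]
  intro j
  unfold unitv
  split_ifs <;> simp

/-- A cutoff function equal to one on the cube of radius `N` around `z` and to zero
outside the cube of radius `2 * N`. -/
def cutoff (d N : ℕ) (z x : Vert d) : ℝ := max 0 (min 1 (2 - ‖x - z‖ / N))

theorem cutoff_eq_one {d N : ℕ} (hN : 1 ≤ N) {z x : Vert d} (hx : x ∈ cube d z N) :
    cutoff d N z x = 1 := by
  have hN' : (0 : ℝ) < N := by exact_mod_cast hN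
  rw [mem_cube_iff_norm_le (by positivity), Int.cast_natCast] at hx
  have : ‖x - z‖ / N ≤ 1 := by rw [div_le_one hN']; exact hx
  rw [cutoff, min_eq_left (by linarith), max_eq_right zero_le_one]

theorem enorm_cutoff_le (d N : ℕ) (z x : Vert d) : ‖cutoff d N z x‖ₑ ≤ 1 := by
  rw [cutoff, Real.enorm_eq_ofReal (le_max_left _ _)]
  exact ENNReal.ofReal_le_one.2 (max_le zero_le_one (min_le_left _ _))

theorem cutoff_eq_zero_of_le {d N : ℕ} (hN : 1 ≤ N) {z x : Vert d} (hx : 2 * N ≤ ‖x - z‖) :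
    cutoff d N z x = 0 := by
  have hN' : (0 : ℝ) < N := by exact_mod_cast hN
  have : 2 ≤ ‖x - z‖ / N := by rwa [le_div_iff₀ hN']
  rw [cutoff, max_eq_left]
  exact (min_le_right _ _).trans (by linarith)

theorem cutoff_eq_zero {d N : ℕ} (hN : 1 ≤ N) {z x : Vert d} (hx : x ∉ cube d z (3 * N)) :
    cutoff d N z x = 0 ∧ ∀ i, cutoff d N z (x + unitv d i) = 0 := by
  have hN' : (1 : ℝ) ≤ N := by exact_mod_cast hN
  rw [mem_cube_iff_norm_le (by positivity)] at hx
  push_cast at hx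
  refine ⟨cutoff_eq_zero_of_le hN (by linarith), fun i => cutoff_eq_zero_of_le hN ?_⟩
  have h1 : ‖x - z‖ ≤ ‖x + unitv d i - z‖ + ‖unitv d i‖ := by
    have : x - z = (x + unitv d i - z) - unitv d i := by abel
    rw [this]; exact norm_sub_le _ _
  have h2 := norm_unitv_le d i
  linarith

theorem enorm_cutoff_sub_le {d N : ℕ} (hN : 1 ≤ N) (z x : Vert d) (i : Fin d) :
    ‖cutoff d N z (x + unitv d i) - cutoff d N z x‖ₑ ≤ ENNReal.ofReal (1 / N) := by
  have hN' : (0 : ℝ) < N := by exact_mod_cast hN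
  rw [Real.enorm_eq_ofReal_abs]
  refine ENNReal.ofReal_le_ofReal ?_
  have h1 : |‖x + unitv d i - z‖ - ‖x - z‖| ≤ 1 := by
    refine (abs_norm_sub_norm_le _ _).trans ?_
    have : x + unitv d i - z - (x - z) = unitv d i := by abel
    rw [this]; exact norm_unitv_le d i
  calc _ ≤ |min 1 (2 - ‖x + unitv d i - z‖ / N) - min 1 (2 - ‖x - z‖ / N)| := by
        simpa [cutoff] using abs_max_sub_max_le_max 0 (min 1 (2 - ‖x + unitv d i - z‖ / N))
          0 (min 1 (2 - ‖x - z‖ / N))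
    _ ≤ |(2 - ‖x + unitv d i - z‖ / N) - (2 - ‖x - z‖ / N)| := by
        simpa using abs_min_sub_min_le_max 1 (2 - ‖x + unitv d i - z‖ / N) 1 (2 - ‖x - z‖ / N)
    _ = |‖x + unitv d i - z‖ - ‖x - z‖| / N := by
        rw [← abs_of_pos hN', ← abs_div, abs_of_pos hN', ← abs_neg]
        congr 1; ring
    _ ≤ 1 / N := by gcongr

theorem tsum_sum_eq_tsum_tsum_ite {d : ℕ} (T : Vert d → Finset (Vert d)) (g : Vert d → ℝ≥0∞) :
    ∑' k, ∑ x ∈ T k, g x = ∑' x, ∑' k, if x ∈ T k then g x else 0 := by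
  rw [ENNReal.tsum_comm]
  refine tsum_congr fun k => ?_
  rw [tsum_eq_sum (s := T k) fun x hx => if_neg hx]
  exact Finset.sum_congr rfl fun x hx => (if_pos hx).symm

theorem tsum_le_tsum_sum_cube {d N : ℕ} (hN : 1 ≤ N) (g : Vert d → ℝ≥0∞) :
    ∑' x, g x ≤ ∑' k : Vert d, ∑ x ∈ cube d ((N : ℤ) • k) N, g x := by
  rw [tsum_sum_eq_tsum_tsum_ite fun k => cube d ((N : ℤ) • k) N]
  refine ENNReal.tsum_le_tsum fun x => ?_
  refine le_trans ?_ (ENNReal.le_tsum fun i => x i / (N : ℤ))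
  rw [if_pos]
  rw [mem_cube]
  intro i
  have hN' : (0 : ℤ) < N := by exact_mod_cast hN
  have h1 := Int.mul_ediv_add_emod (x i) N
  have h2 := Int.emod_nonneg (x i) hN'.ne'
  have h3 := Int.emod_lt_of_pos (x i) hN'
  simp only [Pi.smul_apply, smul_eq_mul]
  omega

theorem tsum_sum_cube_le {d N : ℕ} (hN : 1 ≤ N) (g : Vert d → ℝ≥0∞) :
    ∑' k : Vert d, ∑ x ∈ cube d ((N : ℤ) • k) (3 * N), g x ≤ 7 ^ d * ∑' x, g x := by
  rw [tsum_sum_eq_tsum_tsum_ite fun k => cube d ((N : ℤ) • k) (3 * N), ← ENNReal.tsum_mul_left]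
  refine ENNReal.tsum_le_tsum fun x => ?_
  set Q : Finset (Vert d) := cube d (fun i => x i / (N : ℤ)) 3 with hQ
  have hcard : Q.card = 7 ^ d := by
    have : ∀ t : ℤ, (t + 3 + 1 - (t - 3)).toNat = 7 := fun t => by omega
    simp [hQ, cube, Fintype.card_piFinset, this]
  rw [tsum_eq_sum (s := Q)]
  · calc _ ≤ ∑ _k ∈ Q, g x := Finset.sum_le_sum fun k _ => by split_ifs <;> simp
      _ = _ := by rw [Finset.sum_const, hcard, nsmul_eq_mul]; push_cast; rfl
  · intro k hk
    refine if_neg fun hx => hk ?_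
    rw [hQ, mem_cube]
    rw [mem_cube] at hx
    intro i
    have hN' : (0 : ℤ) < N := by exact_mod_cast hN
    obtain ⟨h4, h5⟩ := hx i
    simp only [Pi.smul_apply, smul_eq_mul] at h4 h5
    have h1 := Int.mul_ediv_add_emod (x i) N
    have h2 := Int.emod_nonneg (x i) hN'.ne'
    have h3 := Int.emod_lt_of_pos (x i) hN'
    constructor
    · by_contra! h
      nlinarith
    · by_contra! h
      nlinarith

/-- A weighted Sobolev inequality on `ℤ^d` under moment bounds on all cubes of scale `N`. -/
theorem weighted_sobolev_of_cube_moments {d : ℕ} (hd : 2 ≤ d) {p q s b : ℝ} (hp : 1 < p)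
    (hq : 1 < q) (hs : 2 ≤ s) (hb : 0 < b) (hbq : 1 / b = (q + 1) / (2 * q) - 1 / (d : ℝ))
    (hbs : b * (1 - 1 / p) = s)
    {c : Vert d → Fin d → ℝ≥0∞} {m : Vert d → ℝ≥0∞}
    (hc0 : ∀ x i, c x i ≠ 0) (hctop : ∀ x i, c x i ≠ ⊤) (hcm : ∀ x i, c x i ≤ m x)
    (f : Vert d → ℝ) {N : ℕ} (hN : 1 ≤ N) {M : ℝ≥0∞}
    (hmM : ∀ z, ∑ x ∈ cube d z (3 * N), m x ^ p ≤ M)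
    (hcM : ∀ z, ∑ x ∈ cube d z (3 * N), ∑ i, c x i ^ (-q) ≤ M) :
    (∑' x, ‖f x‖ₑ ^ s * m x) ^ (2 / s) ≤
      ENNReal.ofReal (2 * d * (b * (d - 1) / d)) ^ 2 * M ^ (2 / (s * p) + 1 / q) *
        (2 * (7 ^ d * ∑' x, (∑ i, c x i * ‖f (x + unitv d i) - f x‖ₑ ^ 2 +
          d * (ENNReal.ofReal (1 / N) ^ 2 * (‖f x‖ₑ ^ 2 * m x))))) := by
  have hs0 : 0 < s := by linarith
  calc _ ≤ (∑' k : Vert d, ∑ x ∈ cube d ((N : ℤ) • k) N, ‖f x‖ₑ ^ s * m x) ^ (2 / s) :=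
        ENNReal.rpow_le_rpow (tsum_le_tsum_sum_cube hN _) (by positivity)
    _ ≤ ∑' k : Vert d, (∑ x ∈ cube d ((N : ℤ) • k) N, ‖f x‖ₑ ^ s * m x) ^ (2 / s) :=
        tsum_rpow_le_of_le_one _ (by positivity) (by rwa [div_le_one hs0])
    _ ≤ ∑' k : Vert d, ENNReal.ofReal (2 * d * (b * (d - 1) / d)) ^ 2 *
          M ^ (2 / (s * p) + 1 / q) * (2 * ∑ x ∈ cube d ((N : ℤ) • k) (3 * N),
          (∑ i, c x i * ‖f (x + unitv d i) - f x‖ₑ ^ 2 +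
            d * (ENNReal.ofReal (1 / N) ^ 2 * (‖f x‖ₑ ^ 2 * m x)))) :=
        ENNReal.tsum_le_tsum fun k => weighted_sobolev_of_cutoff hd hp hq hs0 hb hbq hbs hc0 hctop
          hcm f (cutoff d N ((N : ℤ) • k)) (fun x hx => cutoff_eq_one hN hx)
          (enorm_cutoff_le d N _) (fun x hx => cutoff_eq_zero hN hx) (enorm_cutoff_sub_le hN _)
          (hmM _) (hcM _)
    _ ≤ _ := by
        rw [ENNReal.tsum_mul_left, ENNReal.tsum_mul_left]
        gcongr
        exact tsum_sum_cube_le hN _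

theorem mem_box {d : ℕ} {r : ℝ} {x : Vert d} : x ∈ box d r ↔ ∀ i, |(x i : ℝ)| ≤ r := by
  simp only [box, Fintype.mem_piFinset, Finset.mem_Icc, Int.ceil_le, Int.le_floor, abs_le]

theorem box_mono (d : ℕ) {r r' : ℝ} (h : r ≤ r') : box d r ⊆ box d r' := fun x hx => by
  rw [mem_box] at *
  exact fun i => (hx i).trans h

theorem mem_edgesIn {d : ℕ} {Λ : Finset (Vert d)} {x : Vert d} {i : Fin d} :
    (x, i) ∈ edgesIn d Λ ↔ x ∈ Λ ∨ x + unitv d i ∈ Λ := by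
  simp only [edgesIn, Finset.mem_biUnion, Finset.mem_union, Finset.mem_image, Finset.mem_univ,
    true_and, Prod.mk.injEq]
  constructor
  · rintro ⟨y, hy, ⟨j, rfl, -⟩ | ⟨j, rfl, rfl⟩⟩
    · exact Or.inl hy
    · right; simpa using hy
  · rintro (h | h)
    · exact ⟨x, h, Or.inl ⟨i, rfl, rfl⟩⟩
    · exact ⟨_, h, Or.inr ⟨i, by simp, rfl⟩⟩

theorem edgesIn_mono (d : ℕ) {Λ Λ' : Finset (Vert d)} (h : Λ ⊆ Λ') :
    edgesIn d Λ ⊆ edgesIn d Λ' := by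
  rintro ⟨x, i⟩ hx
  rw [mem_edgesIn] at *
  exact hx.imp (@h x) (@h _)

theorem piOf_nonneg (d : ℕ) (ω : EnvSp d) (x : Vert d) : 0 ≤ piOf d ω x :=
  Finset.sum_nonneg fun _ _ => add_nonneg (ω.2 _).le (ω.2 _).le

theorem cnd_le_piOf (d : ℕ) (ω : EnvSp d) (x : Vert d) (i : Fin d) : ω.1 (x, i) ≤ piOf d ω x :=
  (le_add_of_nonneg_right (ω.2 _).le).trans
    (Finset.single_le_sum (f := fun i => ω.1 (x, i) + ω.1 (x - unitv d i, i))
      (fun _ _ => add_nonneg (ω.2 _).le (ω.2 _).le) (Finset.mem_univ i))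

theorem cR_pos (d : ℕ) (ω : EnvSp d) (R : ℝ) (e : EdgeIx d) : 0 < cR d ω R e := by
  unfold cR
  split_ifs
  · exact ω.2 e
  · exact one_pos

theorem cR_le_piRloc {d : ℕ} (ω : EnvSp d) {R : ℝ} (hR : 1 ≤ R) (x : Vert d) (i : Fin d) :
    cR d ω R (x, i) ≤ piRloc d ω R x := by
  have h0 := piOf_nonneg d ω x
  have h1 := cnd_le_piOf d ω x i
  by_cases hx : x ∈ box d (2 * R)
  · rw [cR, if_pos (mem_edgesIn.2 (Or.inl hx)), piRloc, if_pos hx]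
    exact h1
  · rw [cR, piRloc, if_neg hx]
    by_cases he : (x, i) ∈ edgesIn d (box d (2 * R))
    · have hy := (mem_edgesIn.1 he).resolve_left hx
      have hx4 : x ∈ box d (4 * R) := by
        rw [mem_box] at hy ⊢
        intro j
        have h2 := hy j
        have h3 : |((unitv d i j : ℤ) : ℝ)| ≤ 1 := by
          unfold unitv
          split_ifs <;> simp
        rw [Pi.add_apply, Int.cast_add, abs_le] at h2
        rw [abs_le] at h3 ⊢
        constructor <;> linarith
      rw [if_pos he, if_pos hx4]
      linarith
    · rw [if_neg he]
      split_ifs <;> linarith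

theorem piRloc_nonneg {d : ℕ} (ω : EnvSp d) (R : ℝ) (x : Vert d) : 0 ≤ piRloc d ω R x := by
  have := piOf_nonneg d ω x
  unfold piRloc
  split_ifs <;> linarith

theorem piRloc_le {d : ℕ} (ω : EnvSp d) {R : ℝ} (hR : 1 ≤ R) (x : Vert d) :
    piRloc d ω R x ≤ 1 + if x ∈ box d (4 * R) then piOf d ω x else 0 := by
  have h0 := piOf_nonneg d ω x
  unfold piRloc
  by_cases hx : x ∈ box d (2 * R)
  · rw [if_pos hx, if_pos (box_mono d (by linarith) hx)]
    linarith
  · rw [if_neg hx]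
    split_ifs <;> linarith

theorem card_cube_le {d N : ℕ} (hN : 1 ≤ N) (z : Vert d) :
    ((cube d z (3 * N)).card : ℝ) ≤ 7 ^ d * (N : ℝ) ^ d := by
  have h : ∀ t : ℤ, (t + 3 * (N : ℤ) + 1 - (t - 3 * (N : ℤ))).toNat ≤ 7 * N := fun t => by omega
  have : (cube d z (3 * N)).card ≤ (7 * N) ^ d := by
    rw [cube, Fintype.card_piFinset]
    calc _ ≤ ∏ _i : Fin d, 7 * N := Finset.prod_le_prod' fun i _ => by
          rw [Int.card_Icc]; exact h _
      _ = _ := by simp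
  rw [← mul_pow]
  exact_mod_cast this

theorem sum_comp_le_sum_of_injective {α β : Type*} {s : Finset α} {t : Finset β} {φ : α → β}
    (hφ : Function.Injective φ) (hst : ∀ a ∈ s, φ a ∈ t) {g : β → ℝ} (hg : ∀ b, 0 ≤ g b) :
    ∑ a ∈ s, g (φ a) ≤ ∑ b ∈ t, g b := by
  classical
  rw [← Finset.sum_image (f := g) (s := s) (g := φ) hφ.injOn]
  refine Finset.sum_le_sum_of_subset_of_nonneg ?_ fun b _ _ => hg b
  intro b hb
  obtain ⟨a, ha, rfl⟩ := Finset.mem_image.1 hb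
  exact hst a ha

theorem sum_box_sum_le_sum_edgesIn {d : ℕ} (Λ : Finset (Vert d)) {g : EdgeIx d → ℝ}
    (hg : ∀ e, 0 ≤ g e) :
    ∑ x ∈ Λ, ∑ i, (g (x, i) + g (x - unitv d i, i)) ≤ 2 * ∑ e ∈ edgesIn d Λ, g e := by
  have h1 := sum_comp_le_sum_of_injective (s := Λ ×ˢ (Finset.univ : Finset (Fin d)))
    (t := edgesIn d Λ) (φ := fun e : EdgeIx d => e) (fun _ _ h => h)
    (fun e he => mem_edgesIn.2 (Or.inl (Finset.mem_product.1 he).1)) hg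
  have h2 := sum_comp_le_sum_of_injective (s := Λ ×ˢ (Finset.univ : Finset (Fin d)))
    (t := edgesIn d Λ) (φ := fun e : EdgeIx d => (e.1 - unitv d e.2, e.2))
    (fun e e' h => by
      obtain ⟨x, i⟩ := e
      obtain ⟨y, j⟩ := e'
      simp only [Prod.mk.injEq] at h
      obtain ⟨h1, rfl⟩ := h
      rw [sub_left_inj] at h1
      rw [h1])
    (fun e he => mem_edgesIn.2 (Or.inr (by simpa using (Finset.mem_product.1 he).1))) hg
  rw [Finset.sum_product] at h1 h2
  simp only [Finset.sum_add_distrib]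
  linarith

theorem add_rpow_le_two_rpow_mul {p : ℝ} (hp : 1 ≤ p) {x y : ℝ} (hx : 0 ≤ x) (hy : 0 ≤ y) :
    (x + y) ^ p ≤ 2 ^ (p - 1) * (x ^ p + y ^ p) := by
  have h := Real.rpow_sum_le_const_mul_sum_rpow_of_nonneg (s := Finset.univ) (f := ![x, y]) hp
    (by intro i _; fin_cases i <;> simpa)
  simpa [Fin.sum_univ_two] using h

theorem piOf_rpow_le {d : ℕ} {p : ℝ} (hp : 1 ≤ p) (ω : EnvSp d) (x : Vert d) :
    piOf d ω x ^ p ≤ (d : ℝ) ^ (p - 1) * 2 ^ (p - 1) *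
      ∑ i, (ω.1 (x, i) ^ p + ω.1 (x - unitv d i, i) ^ p) := by
  have h := Real.rpow_sum_le_const_mul_sum_rpow_of_nonneg (s := Finset.univ)
    (f := fun i => ω.1 (x, i) + ω.1 (x - unitv d i, i)) hp
    (fun _ _ => add_nonneg (ω.2 _).le (ω.2 _).le)
  rw [Finset.card_univ, Fintype.card_fin] at h
  refine h.trans ?_
  rw [mul_assoc, Finset.mul_sum (a := (2 : ℝ) ^ (p - 1))]
  gcongr with i _
  exact add_rpow_le_two_rpow_mul hp (ω.2 _).le (ω.2 _).le

theorem sum_edgesIn_box_le {d n : ℕ} (hn : 1 ≤ n) {g : EdgeIx d → ℝ} {C : ℝ}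
    (hC : (∑ e ∈ edgesIn d (box d (n : ℝ)), g e) / (n : ℝ) ^ d ≤ C) {Λ : Finset (Vert d)}
    (hΛ : Λ ⊆ box d n) (hg : ∀ e, 0 ≤ g e) : ∑ e ∈ edgesIn d Λ, g e ≤ C * (n : ℝ) ^ d := by
  have hn0 : (0 : ℝ) < n := by exact_mod_cast hn
  rw [div_le_iff₀ (by positivity)] at hC
  exact (Finset.sum_le_sum_of_subset_of_nonneg (edgesIn_mono d hΛ) fun _ _ _ => hg _).trans hC

theorem exists_sum_cube_piRloc_rpow_le {d : ℕ} {p : ℝ} (hp : 1 ≤ p) (ω : EnvSp d)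
    (hω : ∃ C : ℝ, ∀ n : ℕ, 1 ≤ n →
      (∑ e ∈ edgesIn d (box d (n : ℝ)), ω.1 e ^ p) / (n : ℝ) ^ d ≤ C) :
    ∃ K : ℝ, ∀ R : ℝ, 1 ≤ R → ∀ N : ℕ, R ≤ N → ∀ z,
      ∑ x ∈ cube d z (3 * N), piRloc d ω R x ^ p ≤ K * (N : ℝ) ^ d := by
  obtain ⟨C, hC⟩ := hω
  refine ⟨2 ^ (p - 1) * (7 ^ d + (d : ℝ) ^ (p - 1) * 2 ^ (p - 1) * (2 * (C * 4 ^ d))), ?_⟩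
  intro R hR N hRN z
  have hN : 1 ≤ N := by exact_mod_cast hR.trans hRN
  have hp0 : (0 : ℝ) < p := by linarith
  set Λ := box d (4 * R) with hΛ
  have hω0 : ∀ e, 0 ≤ ω.1 e ^ p := fun e => Real.rpow_nonneg (ω.2 e).le _
  have hpt : ∀ x, piRloc d ω R x ^ p ≤
      2 ^ (p - 1) * (1 + if x ∈ Λ then piOf d ω x ^ p else 0) := by
    intro x
    have h0 := piOf_nonneg d ω x
    refine (Real.rpow_le_rpow (piRloc_nonneg ω R x) (piRloc_le ω hR x) hp0.le).trans ?_
    refine (add_rpow_le_two_rpow_mul hp zero_le_one (by split_ifs <;> simp [h0])).trans_eq ?_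
    rw [Real.one_rpow]
    congr 2
    split_ifs
    · rfl
    · exact Real.zero_rpow hp0.ne'
  have hΛN : Λ ⊆ box d ((4 * N : ℕ) : ℝ) := box_mono d (by push_cast; linarith)
  have hedge := sum_edgesIn_box_le (by omega) (hC (4 * N) (by omega)) hΛN hω0
  have hpi : ∑ x ∈ cube d z (3 * N), (if x ∈ Λ then piOf d ω x ^ p else 0) ≤
      (d : ℝ) ^ (p - 1) * 2 ^ (p - 1) * (2 * (C * ((4 * N : ℕ) : ℝ) ^ d)) := by
    calc _ = ∑ x ∈ cube d z (3 * N) with x ∈ Λ, piOf d ω x ^ p := (Finset.sum_filter _ _).symm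
      _ ≤ ∑ x ∈ Λ, piOf d ω x ^ p := Finset.sum_le_sum_of_subset_of_nonneg
          (fun x hx => (Finset.mem_filter.1 hx).2)
          fun x _ _ => Real.rpow_nonneg (piOf_nonneg d ω x) _
      _ ≤ ∑ x ∈ Λ, (d : ℝ) ^ (p - 1) * 2 ^ (p - 1) *
          ∑ i, (ω.1 (x, i) ^ p + ω.1 (x - unitv d i, i) ^ p) :=
          Finset.sum_le_sum fun x _ => piOf_rpow_le hp ω x
      _ ≤ _ := by
          rw [← Finset.mul_sum]
          gcongr
          refine (sum_box_sum_le_sum_edgesIn Λ hω0).trans ?_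
          gcongr
  calc _ ≤ ∑ x ∈ cube d z (3 * N),
        2 ^ (p - 1) * (1 + if x ∈ Λ then piOf d ω x ^ p else 0) :=
        Finset.sum_le_sum fun x _ => hpt x
    _ = 2 ^ (p - 1) * ((cube d z (3 * N)).card +
        ∑ x ∈ cube d z (3 * N), (if x ∈ Λ then piOf d ω x ^ p else 0)) := by
        rw [← Finset.mul_sum, Finset.sum_add_distrib]; simp
    _ ≤ 2 ^ (p - 1) * (7 ^ d * (N : ℝ) ^ d +
        (d : ℝ) ^ (p - 1) * 2 ^ (p - 1) * (2 * (C * ((4 * N : ℕ) : ℝ) ^ d))) := by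
        gcongr
        exact card_cube_le hN z
    _ = _ := by push_cast; rw [mul_pow]; ring

theorem exists_sum_cube_cR_rpow_le {d : ℕ} {r : ℝ} (ω : EnvSp d)
    (hω : ∃ C : ℝ, ∀ n : ℕ, 1 ≤ n →
      (∑ e ∈ edgesIn d (box d (n : ℝ)), ω.1 e ^ r) / (n : ℝ) ^ d ≤ C) :
    ∃ K : ℝ, ∀ R : ℝ, 1 ≤ R → ∀ N : ℕ, R ≤ N → ∀ z,
      ∑ x ∈ cube d z (3 * N), ∑ i, cR d ω R (x, i) ^ r ≤ K * (N : ℝ) ^ d := by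
  obtain ⟨C, hC⟩ := hω
  refine ⟨d * 7 ^ d + C * 2 ^ d, ?_⟩
  intro R hR N hRN z
  have hN : 1 ≤ N := by exact_mod_cast hR.trans hRN
  set Λ := box d (2 * R) with hΛ
  have hω0 : ∀ e, 0 ≤ ω.1 e ^ r := fun e => Real.rpow_nonneg (ω.2 e).le _
  have hpt : ∀ e, cR d ω R e ^ r ≤ 1 + if e ∈ edgesIn d Λ then ω.1 e ^ r else 0 := by
    intro e
    rw [cR]
    split_ifs
    · linarith
    · simp
  have hΛN : Λ ⊆ box d ((2 * N : ℕ) : ℝ) := box_mono d (by push_cast; linarith)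
  have hedge := sum_edgesIn_box_le (by omega) (hC (2 * N) (by omega)) hΛN hω0
  rw [← Finset.sum_product (f := fun e => cR d ω R e ^ r)]
  calc _ ≤ ∑ e ∈ cube d z (3 * N) ×ˢ (Finset.univ : Finset (Fin d)),
        (1 + if e ∈ edgesIn d Λ then ω.1 e ^ r else 0) := Finset.sum_le_sum fun e _ => hpt e
    _ = (cube d z (3 * N)).card * d + ∑ e ∈ cube d z (3 * N) ×ˢ (Finset.univ : Finset (Fin d))
        with e ∈ edgesIn d Λ, ω.1 e ^ r := by
        rw [Finset.sum_add_distrib, Finset.sum_filter]; simp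
    _ ≤ 7 ^ d * (N : ℝ) ^ d * d + C * ((2 * N : ℕ) : ℝ) ^ d := by
        gcongr
        · exact card_cube_le hN z
        · exact (Finset.sum_le_sum_of_subset_of_nonneg
            (fun x hx => (Finset.mem_filter.1 hx).2) fun e _ _ => hω0 e).trans hedge
    _ = _ := by push_cast; rw [mul_pow]; ring

theorem lpN_sq {d : ℕ} {μ : Vert d → ℝ} {s : ℝ} (hs : 0 ≤ s) (f : Vert d → ℝ) :
    lpN d μ s f ^ 2 = (∑' x, ‖f x‖ₑ ^ s * ENNReal.ofReal (μ x)) ^ (2 / s) := by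
  rw [lpN, ← ENNReal.rpow_natCast, ← ENNReal.rpow_mul]
  congr 1
  · refine tsum_congr fun x => ?_
    rw [ENNReal.ofReal_mul (by positivity), Real.enorm_eq_ofReal_abs,
      ENNReal.ofReal_rpow_of_nonneg (abs_nonneg _) hs]
  · push_cast; ring

theorem DR_eq_tsum_sum (d : ℕ) (ω : EnvSp d) (R : ℝ) (f : Vert d → ℝ) :
    DR d ω R f = ∑' x, ∑ i, ENNReal.ofReal (cR d ω R (x, i)) *
      ‖f (x + unitv d i) - f x‖ₑ ^ 2 := by
  rw [DR, ENNReal.tsum_prod (f := fun x i => ENNReal.ofReal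
    (cR d ω R (x, i) * (f (x + unitv d i) - f x) ^ 2))]
  refine tsum_congr fun x => ?_
  rw [tsum_fintype]
  refine Finset.sum_congr rfl fun i _ => ?_
  rw [ENNReal.ofReal_mul (cR_pos d ω R _).le, Real.enorm_eq_ofReal_abs,
    ← ENNReal.ofReal_pow (abs_nonneg _), sq_abs]

theorem two_add_epsPQ {d : ℕ} (hd : 2 ≤ d) (p : ℝ) {q : ℝ} (hq : 0 < q) :
    2 + epsPQ d p q = 2 * (1 - 1 / p) / (((d : ℝ) - 2) / d + 1 / q) := by
  have hd' : (2 : ℝ) ≤ d := by exact_mod_cast hd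
  have hden : 0 < ((d : ℝ) - 2) / d + 1 / q :=
    add_pos_of_nonneg_of_pos (div_nonneg (by linarith) (by linarith)) (by positivity)
  rw [epsPQ, eq_div_iff hden.ne', add_mul, div_mul_cancel₀ _ hden.ne']
  have hd0 : (d : ℝ) ≠ 0 := by positivity
  field_simp
  ring

theorem epsPQ_pos {d : ℕ} (hd : 2 ≤ d) {p q : ℝ} (hq : 0 < q)
    (hpq : 1 / p + 1 / q < 2 / (d : ℝ)) : 0 < epsPQ d p q := by
  have hd' : (2 : ℝ) ≤ d := by exact_mod_cast hd
  refine div_pos (by linarith) ?_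
  exact add_pos_of_nonneg_of_pos (div_nonneg (by linarith) (by linarith)) (by positivity)

theorem epsPQ_lt {d : ℕ} (hd : 3 ≤ d) {p q : ℝ} (hp : 0 < p) (hq : 0 < q) :
    epsPQ d p q < 4 / ((d : ℝ) - 2) := by
  have hd' : (3 : ℝ) ≤ d := by exact_mod_cast hd
  have hden : 0 < ((d : ℝ) - 2) / d + 1 / q :=
    add_pos_of_nonneg_of_pos (div_nonneg (by linarith) (by linarith)) (by positivity)
  have h2 : 0 < (d : ℝ) - 2 := by linarith
  rw [epsPQ, div_lt_div_iff₀ hden h2]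
  have h1 : 4 * (((d : ℝ) - 2) / d + 1 / q) - 2 * (2 / (d : ℝ) - 1 / p - 1 / q) * ((d : ℝ) - 2) =
      4 / q + 2 * (1 / p + 1 / q) * ((d : ℝ) - 2) := by
    field_simp
    ring
  have h3 : 0 < 4 / q + 2 * (1 / p + 1 / q) * ((d : ℝ) - 2) := by positivity
  linarith

theorem exists_localized_sobolev {d : ℕ} (hd : 2 ≤ d) {p q s : ℝ} (hp : 1 < p) (hq : 1 < q)
    (hs2 : 2 ≤ s) (hs : s = 2 * (1 - 1 / p) / (((d : ℝ) - 2) / d + 1 / q))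
    (ω : EnvSp d) (hmom : InOmegaPQ d p q ω) :
    ∃ c₁ : ℝ, 0 < c₁ ∧ ∀ R : ℝ, 1 ≤ R → ∀ f : Vert d → ℝ,
      lpN d (piRloc d ω R) s f ^ 2 ≤
        ENNReal.ofReal c₁ *
          (ENNReal.ofReal (R ^ (2 - (d : ℝ) * (s - 2) / s)) * DR d ω R f +
            ENNReal.ofReal (R ^ (-((d : ℝ) * (s - 2) / s))) *
              lpN d (piRloc d ω R) 2 f ^ 2) := by
  have hd' : (2 : ℝ) ≤ d := by exact_mod_cast hd
  have hd0 : (0 : ℝ) < d := by linarith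
  have hp0 : 0 < p := by linarith
  have hq0 : 0 < q := by linarith
  have hs0 : 0 < s := by linarith
  have h1p : 0 < 1 - 1 / p := by rw [sub_pos, div_lt_one hp0]; exact hp
  have hden : 0 < ((d : ℝ) - 2) / d + 1 / q :=
    add_pos_of_nonneg_of_pos (div_nonneg (by linarith) (by linarith)) (by positivity)
  have hsden : s * (((d : ℝ) - 2) / d + 1 / q) = 2 * (1 - 1 / p) := by
    rw [hs, div_mul_cancel₀ _ hden.ne']
  obtain ⟨K₁, hK₁⟩ := exists_sum_cube_piRloc_rpow_le hp.le ω hmom.1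
  obtain ⟨K₂, hK₂⟩ := exists_sum_cube_cR_rpow_le ω hmom.2
  set K : ℝ := max 1 (max K₁ K₂) with hK
  have hK0 : 0 < K := lt_of_lt_of_le one_pos (le_max_left _ _)
  set b : ℝ := s / (1 - 1 / p) with hb_def
  have hb : 0 < b := div_pos hs0 h1p
  have hbs : b * (1 - 1 / p) = s := div_mul_cancel₀ _ h1p.ne'
  have hbq : 1 / b = (q + 1) / (2 * q) - 1 / (d : ℝ) := by
    have h1 : 1 / b = (((d : ℝ) - 2) / d + 1 / q) / 2 := by
      rw [hb_def, one_div_div, div_eq_div_iff hs0.ne' two_ne_zero]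
      linarith
    rw [h1]; field_simp; ring
  set θ : ℝ := 2 / (s * p) + 1 / q with hθ
  have hθ0 : 0 < θ := by positivity
  have hdθ : d * θ = 2 - (d : ℝ) * (s - 2) / s := by
    have h1 : (d : ℝ) - 2 + d / q = 2 * d * (1 - 1 / p) / s := by
      rw [eq_div_iff hs0.ne']
      have : (d : ℝ) - 2 + d / q = d * (((d : ℝ) - 2) / d + 1 / q) := by field_simp
      rw [this, mul_assoc, mul_comm _ s, hsden]; ring
    have h2 : d * θ = 2 * d / (s * p) + d / q := by rw [hθ]; ring
    have h3 : 2 * d * (1 - 1 / p) / s = 2 * d / s - 2 * d / (s * p) := by field_simp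
    have h4 : (d : ℝ) * (s - 2) / s = d - 2 * d / s := by field_simp
    rw [h2, h4]
    linarith
  have hd1 : (0 : ℝ) < d - 1 := by linarith
  obtain ⟨L, hL⟩ : ∃ L : ℝ, 2 * d * (b * (d - 1) / d) = L := ⟨_, rfl⟩
  have hL0 : 0 < L := hL ▸ (by positivity)
  set A : ℝ := L ^ 2 * (K * 2 ^ d) ^ θ * (2 * 7 ^ d) with hA
  have hA0 : 0 < A := by positivity
  refine ⟨A * d, by positivity, fun R hR f => ?_⟩
  have hR0 : 0 < R := by linarith
  set N : ℕ := ⌈R⌉₊ with hN_def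
  have hRN : R ≤ N := Nat.le_ceil R
  have hN : 1 ≤ N := by exact_mod_cast hR.trans hRN
  have hN2 : (N : ℝ) ≤ 2 * R := by
    have := Nat.ceil_lt_add_one hR0.le
    linarith
  set M : ℝ := K * (2 * R) ^ d with hM
  have hM0 : 0 ≤ M := by positivity
  have hmM : ∀ z, ∑ x ∈ cube d z (3 * N), ENNReal.ofReal (piRloc d ω R x) ^ p ≤
      ENNReal.ofReal M := by
    intro z
    simp only [ENNReal.ofReal_rpow_of_nonneg (piRloc_nonneg ω R _) hp0.le]
    rw [← ENNReal.ofReal_sum_of_nonneg fun x _ => Real.rpow_nonneg (piRloc_nonneg ω R x) _]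
    refine ENNReal.ofReal_le_ofReal ((hK₁ R hR N hRN z).trans ?_)
    have : K₁ ≤ K := (le_max_left _ _).trans (le_max_right _ _)
    rw [hM]
    gcongr
  have hcM : ∀ z, ∑ x ∈ cube d z (3 * N), ∑ i, ENNReal.ofReal (cR d ω R (x, i)) ^ (-q) ≤
      ENNReal.ofReal M := by
    intro z
    have h0 : ∀ x i, 0 ≤ cR d ω R (x, i) ^ (-q) := fun x i => Real.rpow_nonneg (cR_pos _ _ _ _).le _
    simp only [ENNReal.ofReal_rpow_of_pos (cR_pos d ω R _)]
    simp only [← ENNReal.ofReal_sum_of_nonneg fun i _ => h0 _ i]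
    rw [← ENNReal.ofReal_sum_of_nonneg fun x _ => Finset.sum_nonneg fun i _ => h0 x i]
    refine ENNReal.ofReal_le_ofReal ((hK₂ R hR N hRN z).trans ?_)
    have : K₂ ≤ K := (le_max_right _ _).trans (le_max_right _ _)
    rw [hM]
    gcongr
  have hmain := weighted_sobolev_of_cube_moments hd hp hq hs2 hb hbq hbs
    (c := fun x i => ENNReal.ofReal (cR d ω R (x, i)))
    (m := fun x => ENNReal.ofReal (piRloc d ω R x))
    (fun x i => (ENNReal.ofReal_pos.2 (cR_pos d ω R _)).ne') (fun _ _ => ENNReal.ofReal_ne_top)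
    (fun x i => ENNReal.ofReal_le_ofReal (cR_le_piRloc ω hR x i)) f hN hmM hcM
  have hl2 : lpN d (piRloc d ω R) 2 f ^ 2 =
      ∑' x, ‖f x‖ₑ ^ 2 * ENNReal.ofReal (piRloc d ω R x) := by
    rw [lpN_sq zero_le_two]
    norm_num
  rw [hL] at hmain
  rw [lpN_sq hs0.le]
  refine hmain.trans ?_
  rw [ENNReal.tsum_add, ENNReal.tsum_mul_left, ENNReal.tsum_mul_left, ← DR_eq_tsum_sum, ← hl2]
  have hMθ : M ^ θ = (K * 2 ^ d) ^ θ * R ^ (2 - (d : ℝ) * (s - 2) / s) := by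
    rw [hM, mul_pow, ← mul_assoc, Real.mul_rpow (by positivity) (by positivity), ← hdθ,
      ← Real.rpow_natCast R, ← Real.rpow_mul hR0.le]
  have hRpow : R ^ (-((d : ℝ) * (s - 2) / s)) = R ^ (2 - (d : ℝ) * (s - 2) / s) * (1 / R) ^ 2 := by
    rw [one_div, inv_pow, ← Real.rpow_natCast R 2, ← Real.rpow_neg hR0.le, ← Real.rpow_add hR0]
    congr 1; push_cast; ring
  rw [ENNReal.ofReal_rpow_of_nonneg hM0 hθ0.le, hMθ, hRpow]
  set P : ℝ := R ^ (2 - (d : ℝ) * (s - 2) / s) with hP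
  have hP0 : 0 ≤ P := Real.rpow_nonneg hR0.le _
  have hNR : ENNReal.ofReal (1 / N) ≤ ENNReal.ofReal (1 / R) :=
    ENNReal.ofReal_le_ofReal (one_div_le_one_div_of_le hR0 hRN)
  have hd1' : (1 : ℝ≥0∞) ≤ d := by exact_mod_cast (by omega : 1 ≤ d)
  have hAeq : ENNReal.ofReal A =
      ENNReal.ofReal L ^ 2 * ENNReal.ofReal ((K * 2 ^ d) ^ θ) * (2 * 7 ^ d) := by
    rw [hA, ENNReal.ofReal_mul (by positivity), ENNReal.ofReal_mul (by positivity),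
      ENNReal.ofReal_pow hL0.le, ENNReal.ofReal_mul zero_le_two, ENNReal.ofReal_pow (by norm_num),
      ENNReal.ofReal_ofNat, ENNReal.ofReal_ofNat]
  rw [ENNReal.ofReal_mul hA0.le, hAeq, ENNReal.ofReal_mul (p := (K * 2 ^ d) ^ θ) (by positivity),
    ENNReal.ofReal_mul hP0, ENNReal.ofReal_pow (by positivity), ENNReal.ofReal_natCast]
  set D := DR d ω R f
  set T := lpN d (piRloc d ω R) 2 f ^ 2
  calc _ ≤ ENNReal.ofReal L ^ 2 * (ENNReal.ofReal ((K * 2 ^ d) ^ θ) * ENNReal.ofReal P) *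
        (2 * (7 ^ d * (d * D + d * (ENNReal.ofReal (1 / R) ^ 2 * T)))) := by
        gcongr
        exact le_mul_of_one_le_left' hd1'
    _ = _ := by ring

/-- STATEMENT 18 (Proposition 7.1): localized Nash–Sobolev inequality. -/
theorem statement18 (d : ℕ) (hd : 2 ≤ d) (p q : ℝ)
    (hp : (d : ℝ) / 2 < p) (hq : (d : ℝ) / 2 < q) (hpq : 1 / p + 1 / q < 2 / (d : ℝ))
    (ω : EnvSp d) (hmom : InOmegaPQ d p q ω) :
    0 < epsPQ d p q ∧ (3 ≤ d → epsPQ d p q < 4 / ((d : ℝ) - 2)) ∧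
    ∃ c₁ : ℝ, 0 < c₁ ∧ ∀ R : ℝ, 1 ≤ R → ∀ f : Vert d → ℝ,
      lpN d (piRloc d ω R) 2 f ≠ ⊤ →
      lpN d (piRloc d ω R) (2 + epsPQ d p q) f ^ 2 ≤
        ENNReal.ofReal c₁ *
          (ENNReal.ofReal (R ^ (2 - (d : ℝ) * epsPQ d p q / (2 + epsPQ d p q))) *
              DR d ω R f +
            ENNReal.ofReal (R ^ (-((d : ℝ) * epsPQ d p q / (2 + epsPQ d p q)))) *
              lpN d (piRloc d ω R) 2 f ^ 2) := by
  have hd' : (2 : ℝ) ≤ d := by exact_mod_cast hd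
  have hp1 : 1 < p := by linarith
  have hq1 : 1 < q := by linarith
  have hε := epsPQ_pos hd (by linarith) hpq
  refine ⟨hε, fun hd3 => epsPQ_lt hd3 (by linarith) (by linarith), ?_⟩
  obtain ⟨c₁, hc₁, h⟩ := exists_localized_sobolev hd hp1 hq1 (s := 2 + epsPQ d p q) (by linarith)
    (two_add_epsPQ hd p (by linarith)) ω hmom
  simp only [add_sub_cancel_left] at h
  exact ⟨c₁, hc₁, fun R hR f _ => h R hR f⟩


end DetCond
end
end
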